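/- arXiv:1806.03186 — 2 statements merged into one kernel-verified Lean document; each statement's English description precedes it below -/
import Mathlib

section
/- Assume d > 1, and for E ∈ ℝ set ϰ(E) = min{|E − L₋|, |E − L₊|}. There exist constants q₀, c₁, C₁ > 0, depending only on d and C₀, such that for every q ≥ q₀ and every z = E + iη ∈ 𝓔: (i) if E > L₊ then c₁ η/√(ϰ(E)+η) ≤ Im m̃(z) ≤ C₁ η/√(ϰ(E)+η); (ii) if L₊ − 1/√d ≤ E ≤ L₊ then c₁ √(ϰ(E)+η) ≤ Im m̃(z) ≤ C₁ √(ϰ(E)+η); (iii) if E < L₊ − 1/√d then Im m̃(z) ≤ C₁. -/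
open Complex MeasureTheory

/-- The quartic polynomial `P_z(w) = 1 + (z+1-1/d)w + zw² + (s₄/q²)w²(zw+1-1/d)²`. -/
noncomputable def Ppoly (d s4 q : ℝ) (z w : ℂ) : ℂ :=
  1 + (z + 1 - 1/(d:ℂ)) * w + z * w^2 + ((s4:ℂ)/(q:ℂ)^2) * w^2 * (z*w + 1 - 1/(d:ℂ))^2

/-- Stieltjes transform of a measure on ℝ. -/
noncomputable def stTrans (ρ : Measure ℝ) (z : ℂ) : ℂ := ∫ x : ℝ, ((x : ℂ) - z)⁻¹ ∂ρ

/-- The (topological) support of a measure on ℝ. -/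
def measSupport (ρ : Measure ℝ) : Set ℝ := {x : ℝ | ∀ U ∈ nhds x, ρ U ≠ 0}

noncomputable def lamPlus (d : ℝ) : ℝ := (1 + 1/Real.sqrt d)^2
noncomputable def lamMinus (d : ℝ) : ℝ := (1 - 1/Real.sqrt d)^2

/-- The spectral domain `𝓔` in the case `d > 1`. -/
noncomputable def specDomGT (d : ℝ) : Set ℂ :=
  {z : ℂ | lamMinus d / 2 ≤ z.re ∧ z.re ≤ lamPlus d + 1 ∧ 0 < z.im ∧ z.im < 3}

/-- Distance of `E` to the endpoints `L₋ = inf (supp ρ̃)` and `L₊ = sup (supp ρ̃)`. -/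
noncomputable def kappaDist (ρ : Measure ℝ) (E : ℝ) : ℝ :=
  min |E - sInf (measSupport ρ)| |E - sSup (measSupport ρ)|

section StieltjesTransform

variable {ρ : Measure ℝ}

lemma im_le_norm_ofReal_sub (x : ℝ) (z : ℂ) : z.im ≤ ‖(x : ℂ) - z‖ := by
  have h := abs_im_le_norm ((x : ℂ) - z)
  simp only [sub_im, ofReal_im, zero_sub, abs_neg] at h
  exact (le_abs_self _).trans h

lemma ofReal_sub_ne_zero (x : ℝ) {z : ℂ} (hz : 0 < z.im) : (x : ℂ) - z ≠ 0 :=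
  norm_pos_iff.1 (hz.trans_le (im_le_norm_ofReal_sub x z))

lemma norm_inv_ofReal_sub_le (x : ℝ) {z : ℂ} (hz : 0 < z.im) :
    ‖((x : ℂ) - z)⁻¹‖ ≤ 1 / z.im := by
  rw [norm_inv, ← one_div]
  exact one_div_le_one_div_of_le hz (im_le_norm_ofReal_sub x z)

lemma measurable_inv_ofReal_sub (z : ℂ) : Measurable fun x : ℝ => ((x : ℂ) - z)⁻¹ :=
  (Complex.measurable_ofReal.sub_const z).inv

lemma integrable_inv_ofReal_sub [IsFiniteMeasure ρ] {z : ℂ} (hz : 0 < z.im) :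
    Integrable (fun x : ℝ => ((x : ℂ) - z)⁻¹) ρ :=
  Integrable.of_bound (measurable_inv_ofReal_sub z).aestronglyMeasurable (1 / z.im)
    (Filter.Eventually.of_forall fun x => norm_inv_ofReal_sub_le x hz)

lemma norm_stTrans_le [IsProbabilityMeasure ρ] {z : ℂ} (hz : 0 < z.im) :
    ‖stTrans ρ z‖ ≤ 1 / z.im := by
  have h := norm_integral_le_of_norm_le_const (μ := ρ)
    (Filter.Eventually.of_forall fun x : ℝ => norm_inv_ofReal_sub_le x hz)
  simpa [stTrans] using h

lemma continuousOn_stTrans [IsFiniteMeasure ρ] {δ : ℝ} (hδ : 0 < δ) :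
    ContinuousOn (stTrans ρ) {z : ℂ | δ ≤ z.im} := by
  refine continuousOn_of_dominated (bound := fun _ => 1 / δ)
    (fun z _ => (measurable_inv_ofReal_sub z).aestronglyMeasurable)
    (fun z hz => Filter.Eventually.of_forall fun x =>
      (norm_inv_ofReal_sub_le x (hδ.trans_le hz)).trans (one_div_le_one_div_of_le hδ hz))
    (integrable_const _) (Filter.Eventually.of_forall fun x => ?_)
  exact (continuousOn_const.sub continuousOn_id).inv₀
    fun z hz => ofReal_sub_ne_zero x (hδ.trans_le hz)

lemma im_inv_ofReal_sub (x : ℝ) (z : ℂ) :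
    ((((x : ℂ) - z)⁻¹).im) = z.im * ‖((x : ℂ) - z)⁻¹‖ ^ 2 := by
  rw [inv_im, norm_inv, inv_pow, ← normSq_eq_norm_sq]
  simp [div_eq_mul_inv]

lemma norm_sq_inv_ofReal_sub (x : ℝ) (z : ℂ) :
    ‖((x : ℂ) - z)⁻¹‖ ^ 2 = 1 / ((x - z.re) ^ 2 + z.im ^ 2) := by
  rw [norm_inv, inv_pow, ← normSq_eq_norm_sq, normSq_apply]
  simp only [sub_re, ofReal_re, sub_im, ofReal_im]
  ring

lemma integrable_norm_sq_inv_ofReal_sub [IsFiniteMeasure ρ] {z : ℂ} (hz : 0 < z.im) :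
    Integrable (fun x : ℝ => ‖((x : ℂ) - z)⁻¹‖ ^ 2) ρ := by
  refine Integrable.of_bound
    ((measurable_inv_ofReal_sub z).norm.pow_const 2).aestronglyMeasurable ((1 / z.im) ^ 2)
    (Filter.Eventually.of_forall fun x => ?_)
  rw [Real.norm_of_nonneg (by positivity)]
  gcongr
  exact norm_inv_ofReal_sub_le x hz

lemma stTrans_im [IsFiniteMeasure ρ] {z : ℂ} (hz : 0 < z.im) :
    (stTrans ρ z).im = z.im * ∫ x : ℝ, ‖((x : ℂ) - z)⁻¹‖ ^ 2 ∂ρ := by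
  have h := integral_im (𝕜 := ℂ) (integrable_inv_ofReal_sub (ρ := ρ) hz)
  simp only [RCLike.im_eq_complex_im] at h
  rw [stTrans, ← h, ← integral_const_mul]
  exact integral_congr_ae (Filter.Eventually.of_forall fun x => im_inv_ofReal_sub x z)

lemma stTrans_im_nonneg [IsFiniteMeasure ρ] {z : ℂ} (hz : 0 < z.im) :
    0 ≤ (stTrans ρ z).im := by
  rw [stTrans_im hz]
  have : 0 ≤ ∫ x : ℝ, ‖((x : ℂ) - z)⁻¹‖ ^ 2 ∂ρ := integral_nonneg fun x => by positivity
  positivity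

/-- The Cauchy–Schwarz bound `Im m(z) ≥ Im z · |m(z)|²`. -/
lemma im_mul_norm_sq_stTrans_le [IsProbabilityMeasure ρ] {z : ℂ} (hz : 0 < z.im) :
    z.im * ‖stTrans ρ z‖ ^ 2 ≤ (stTrans ρ z).im := by
  rw [stTrans_im hz]
  refine mul_le_mul_of_nonneg_left ?_ hz.le
  have h1 : ‖stTrans ρ z‖ ≤ ∫ x : ℝ, ‖((x : ℂ) - z)⁻¹‖ ∂ρ := norm_integral_le_integral_norm _
  have h2 : (∫ x : ℝ, ‖((x : ℂ) - z)⁻¹‖ ∂ρ) ^ 2 ≤ ∫ x : ℝ, ‖((x : ℂ) - z)⁻¹‖ ^ 2 ∂ρ := by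
    have hi := (integrable_inv_ofReal_sub (ρ := ρ) hz).norm
    exact (even_two.convexOn_pow (𝕜 := ℝ)).map_integral_le (continuous_pow 2).continuousOn
      isClosed_univ (by simp) hi (integrable_norm_sq_inv_ofReal_sub hz)
  exact (pow_le_pow_left₀ (norm_nonneg _) h1 2).trans h2

lemma measureReal_Icc_le_stTrans_im [IsFiniteMeasure ρ] (E : ℝ) {η : ℝ} (hη : 0 < η) :
    ρ.real (Set.Icc (E - η) (E + η)) ≤ 2 * η * (stTrans ρ (E + η * I)).im := by
  set z : ℂ := E + η * I with hz
  have hre : z.re = E := by simp [hz]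
  have him : z.im = η := by simp [hz]
  have hzp : 0 < z.im := him ▸ hη
  have hi := integrable_norm_sq_inv_ofReal_sub (ρ := ρ) hzp
  have h1 : ρ.real (Set.Icc (E - η) (E + η)) * (1 / (2 * η ^ 2))
      ≤ ∫ x : ℝ, ‖((x : ℂ) - z)⁻¹‖ ^ 2 ∂ρ := by
    calc _ = ∫ x in Set.Icc (E - η) (E + η), 1 / (2 * η ^ 2) ∂ρ := by simp
      _ ≤ ∫ x in Set.Icc (E - η) (E + η), ‖((x : ℂ) - z)⁻¹‖ ^ 2 ∂ρ := by
        refine setIntegral_mono_on (integrable_const _).integrableOn hi.integrableOn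
          measurableSet_Icc fun x hx => ?_
        rw [norm_sq_inv_ofReal_sub, hre, him]
        refine one_div_le_one_div_of_le (by positivity) ?_
        nlinarith [hx.1, hx.2]
      _ ≤ _ := setIntegral_le_integral hi (Filter.Eventually.of_forall fun x => by positivity)
  rw [stTrans_im hzp, him]
  calc _ = 2 * η ^ 2 * (ρ.real (Set.Icc (E - η) (E + η)) * (1 / (2 * η ^ 2))) := by field_simp
    _ ≤ 2 * η ^ 2 * ∫ x : ℝ, ‖((x : ℂ) - z)⁻¹‖ ^ 2 ∂ρ := by gcongr
    _ = _ := by ring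

/-- If `Im m(E + iη) = O(η)` uniformly in `E ∈ [a, b]`, then `ρ` does not charge `(a, b]`. -/
lemma measure_Ioc_eq_zero_of_stTrans_im_le [IsFiniteMeasure ρ] {a b C η₀ : ℝ} (hη₀ : 0 < η₀)
    (h : ∀ E ∈ Set.Icc a b, ∀ η : ℝ, 0 < η → η < η₀ → (stTrans ρ (E + η * I)).im ≤ C * η) :
    ρ (Set.Ioc a b) = 0 := by
  rcases le_or_gt b a with hba | hab
  · simp [Set.Ioc_eq_empty_of_le hba]
  set f : ℝ → ℝ := fun x => ρ.real (Set.Ioc a x) with hf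
  have hsub : ∀ x y, a ≤ x → x ≤ y → f y - f x = ρ.real (Set.Ioc x y) := by
    intro x y hx hxy
    have : Set.Ioc a y = Set.Ioc a x ∪ Set.Ioc x y := (Set.Ioc_union_Ioc_eq_Ioc hx hxy).symm
    simp only [hf]
    rw [this, measureReal_union (Set.Ioc_disjoint_Ioc_of_le le_rfl) measurableSet_Ioc]
    ring
  have hbd : ∀ x y, a ≤ x → y ≤ b → x ≤ y → y - x < η₀ → |f y - f x| ≤ 2 * |C| * (y - x) ^ 2 := by
    intro x y hx hy hxy hlt
    rw [hsub x y hx hxy, abs_of_nonneg measureReal_nonneg]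
    rcases hxy.eq_or_lt with rfl | hxy'
    · simp
    have h1 := measureReal_Icc_le_stTrans_im (ρ := ρ) x (sub_pos.2 hxy')
    have h2 := h x ⟨hx, hxy.trans hy⟩ (y - x) (sub_pos.2 hxy') hlt
    have h3 : ρ.real (Set.Ioc x y) ≤ ρ.real (Set.Icc (x - (y - x)) (x + (y - x))) :=
      measureReal_mono fun t ht => ⟨by linarith [ht.1], by linarith [ht.2]⟩
    have h4 : C * (y - x) ≤ |C| * (y - x) :=
      mul_le_mul_of_nonneg_right (le_abs_self _) (sub_pos.2 hxy').le
    nlinarith [sub_pos.2 hxy']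
  have hder : ∀ x ∈ Set.Icc a b, HasDerivWithinAt f 0 (Set.Icc a b) x := by
    intro x hx
    rw [hasDerivWithinAt_iff_isLittleO]
    simp only [smul_zero, sub_zero]
    have hO : (fun y => f y - f x) =O[nhdsWithin x (Set.Icc a b)] fun y => (y - x) ^ 2 := by
      refine Asymptotics.IsBigO.of_bound (2 * |C|) ?_
      filter_upwards [self_mem_nhdsWithin, mem_nhdsWithin_of_mem_nhds (Metric.ball_mem_nhds x hη₀)]
        with y hy hy'
      rw [Metric.mem_ball, Real.dist_eq] at hy'
      rw [Real.norm_eq_abs, Real.norm_of_nonneg (sq_nonneg _)]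
      rcases le_total x y with hxy | hxy
      · exact hbd x y hx.1 hy.2 hxy ((le_abs_self _).trans_lt hy')
      · rw [abs_sub_comm, ← neg_sub x y, neg_sq]
        exact hbd y x hy.1 hx.2 hxy (by rw [abs_sub_comm] at hy'; exact (le_abs_self _).trans_lt hy')
    refine hO.trans_isLittleO ?_
    have := Asymptotics.isLittleO_pow_sub_sub x (m := 2) (by norm_num)
    simpa using this.mono nhdsWithin_le_nhds
  have hc : ContinuousOn f (Set.Icc a b) := fun x hx => (hder x hx).continuousWithinAt
  have := constant_of_has_deriv_right_zero hc (fun x hx =>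
    ((hder x ⟨hx.1, hx.2.le⟩).mono_of_mem_nhdsWithin
      (Icc_mem_nhdsGE_of_mem hx))) b ⟨hab.le, le_rfl⟩
  simp only [hf, Set.Ioc_self, measureReal_empty] at this
  exact (measureReal_eq_zero_iff).1 this

/-- A point above which `Im m(E + iη)` stays bounded below belongs to the support. -/
lemma mem_measSupport_of_le_stTrans_im [IsFiniteMeasure ρ] {E c η₀ : ℝ} (hc : 0 < c) (hη₀ : 0 < η₀)
    (h : ∀ η : ℝ, 0 < η → η < η₀ → c ≤ (stTrans ρ (E + η * I)).im) : E ∈ measSupport ρ := by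
  intro U hU hU0
  obtain ⟨r, hr, hrU⟩ := Metric.mem_nhds_iff.1 hU
  have hnull : ρ (Metric.ball E r) = 0 := measure_mono_null hrU hU0
  set M : ℝ := ρ.real Set.univ / r ^ 2 with hM
  have hM0 : 0 ≤ M := by positivity
  have key : ∀ η : ℝ, 0 < η → (stTrans ρ (E + η * I)).im ≤ η * M := by
    intro η hη
    set z : ℂ := E + η * I with hz
    have hre : z.re = E := by simp [hz]
    have him : z.im = η := by simp [hz]
    have hzp : 0 < z.im := him ▸ hη
    rw [stTrans_im hzp, him]
    refine mul_le_mul_of_nonneg_left ?_ hη.le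
    have hae : ∀ᵐ x : ℝ ∂ρ, ‖((x : ℂ) - z)⁻¹‖ ^ 2 ≤ 1 / r ^ 2 := by
      have : ∀ᵐ x : ℝ ∂ρ, x ∉ Metric.ball E r := measure_eq_zero_iff_ae_notMem.1 hnull
      filter_upwards [this] with x hx
      rw [Metric.mem_ball, Real.dist_eq, not_lt] at hx
      rw [norm_sq_inv_ofReal_sub, hre, him]
      refine one_div_le_one_div_of_le (by positivity) ?_
      nlinarith [sq_abs (x - E)]
    calc _ ≤ ∫ _, 1 / r ^ 2 ∂ρ :=
          integral_mono_ae (integrable_norm_sq_inv_ofReal_sub hzp) (integrable_const _) hae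
      _ = M := by simp [hM, div_eq_mul_inv]
  set η : ℝ := min (η₀ / 2) (c / (2 * (M + 1))) with hη
  have h1 : 0 < η := by positivity
  have h2 := h η h1 ((min_le_left _ _).trans_lt (by linarith))
  have h3 := key η h1
  have h4 : η * (2 * (M + 1)) ≤ c := by
    rw [← le_div_iff₀ (by positivity)]
    exact min_le_right _ _
  nlinarith

end StieltjesTransform

section ImBound

lemma abs_im_mul_le (x y : ℂ) : |(x * y).im| ≤ |x.im| * ‖y‖ + ‖x‖ * |y.im| := by
  rw [mul_im]
  calc |x.re * y.im + x.im * y.re| ≤ |x.re| * |y.im| + |x.im| * |y.re| := by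
        simpa only [abs_mul] using abs_add_le (x.re * y.im) (x.im * y.re)
    _ ≤ ‖x‖ * |y.im| + |x.im| * ‖y‖ := by
        gcongr
        · exact abs_re_le_norm x
        · exact abs_re_le_norm y
    _ = _ := add_comm _ _

/-- `x` has norm at most `A` and imaginary part at most `B * δ`. -/
def ImBound (δ A B : ℝ) (x : ℂ) : Prop := ‖x‖ ≤ A ∧ |x.im| ≤ B * δ

variable {δ A B A' B' : ℝ} {x y : ℂ}

lemma ImBound.add (hx : ImBound δ A B x) (hy : ImBound δ A' B' y) :
    ImBound δ (A + A') (B + B') (x + y) :=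
  ⟨(norm_add_le _ _).trans (add_le_add hx.1 hy.1), by
    rw [add_im, add_mul]; exact (abs_add_le _ _).trans (add_le_add hx.2 hy.2)⟩

lemma ImBound.mul (hx : ImBound δ A B x) (hy : ImBound δ A' B' y) :
    ImBound δ (A * A') (B * A' + A * B') (x * y) := by
  have hA := (norm_nonneg x).trans hx.1
  have hA' := (norm_nonneg y).trans hy.1
  have hB := (abs_nonneg _).trans hx.2
  refine ⟨?_, (abs_im_mul_le x y).trans ?_⟩
  · rw [norm_mul]
    exact mul_le_mul hx.1 hy.1 (norm_nonneg _) hA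
  · have h1 := mul_le_mul hx.2 hy.1 (norm_nonneg _) hB
    have h2 := mul_le_mul hx.1 hy.2 (abs_nonneg _) hA
    linarith

lemma ImBound.ofReal {t : ℝ} (ht : |t| ≤ A) : ImBound δ A 0 (t : ℂ) :=
  ⟨by simpa using ht, by simp⟩

lemma ImBound.mono (hx : ImBound δ A B x) (hδ : 0 ≤ δ) (hA : A ≤ A') (hB : B ≤ B') :
    ImBound δ A' B' x :=
  ⟨hx.1.trans hA, hx.2.trans (mul_le_mul_of_nonneg_right hB hδ)⟩

end ImBound

section EdgePolynomial

/-- The polynomial `P_z(w)` with `a = 1 - 1/d` and `ε = s₄/q²`. -/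
noncomputable def edgePoly (a ε : ℝ) (z w : ℂ) : ℂ :=
  1 + (z + a) * w + z * w ^ 2 + ε * (w * (z * w + a)) ^ 2

lemma Ppoly_eq_edgePoly (d s4 q : ℝ) (z w : ℂ) :
    Ppoly d s4 q z w = edgePoly (1 - 1 / d) (s4 / q ^ 2) z w := by
  simp only [Ppoly, edgePoly]
  push_cast
  ring

lemma norm_ofReal_mul_sq_le {a ε M K : ℝ} {z w : ℂ} (ha : |a| ≤ 1) (hz : ‖z‖ ≤ M) (hw : ‖w‖ ≤ K)
    (hε : |ε| * (K * (M * K + 1)) ^ 2 ≤ 1) : ‖(ε : ℂ) * (w * (z * w + a)) ^ 2‖ ≤ 1 := by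
  have hM := (norm_nonneg z).trans hz
  have hK := (norm_nonneg w).trans hw
  have h1 : ‖z * w + a‖ ≤ M * K + 1 := by
    refine (norm_add_le _ _).trans (add_le_add ?_ (by simpa using ha))
    rw [norm_mul]
    exact mul_le_mul hz hw (norm_nonneg _) hM
  rw [norm_mul, norm_pow, norm_mul, norm_real, Real.norm_eq_abs]
  refine le_trans ?_ hε
  gcongr

/-- Bounded solutions of `P_z(w) = 0` are separated from the large ones. -/
lemma norm_ne_of_edgePoly_eq_zero {a ε c M : ℝ} {z w : ℂ} (ha : |a| ≤ 1) (hc : 0 < c)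
    (hcz : c ≤ ‖z‖) (hzM : ‖z‖ ≤ M)
    (hε : |ε| * ((2 + 3 / c) * (M * (2 + 3 / c) + 1)) ^ 2 ≤ 1)
    (h : edgePoly a ε z w = 0) : ‖w‖ ≠ 2 + 3 / c := by
  intro hw
  set K : ℝ := 2 + 3 / c with hK
  have hr := norm_ofReal_mul_sq_le ha hzM hw.le hε
  have heq : z * w ^ 2 = -(1 + (z + a) * w + ε * (w * (z * w + a)) ^ 2) := by
    rw [edgePoly] at h
    linear_combination h
  have h1 : ‖z * w ^ 2‖ ≤ 1 + (‖z‖ + 1) * K + 1 := by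
    rw [heq, norm_neg]
    refine (norm_add₃_le).trans ?_
    rw [norm_one, norm_mul, hw]
    have : ‖z + a‖ ≤ ‖z‖ + 1 := (norm_add_le _ _).trans (by simpa using ha)
    have hK0 : 0 < K := by positivity
    gcongr
  rw [norm_mul, norm_pow, hw] at h1
  have h2 : 3 ≤ ‖z‖ * (3 / c) := by
    calc (3 : ℝ) = c * (3 / c) := by field_simp
      _ ≤ _ := by gcongr
  have hK2 : 2 ≤ K := by
    have : 0 < 3 / c := by positivity
    linarith
  have h3 : ‖z‖ * K ^ 2 = K * (2 * ‖z‖ + ‖z‖ * (3 / c)) := by rw [hK]; ring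
  nlinarith [norm_nonneg z]

/-- For large `z`, the solution close to `-1/z` is separated from the others. -/
lemma norm_mul_ne_two_of_edgePoly_eq_zero {a ε : ℝ} {z w : ℂ} (ha : |a| ≤ 1) (hε : |ε| ≤ 1)
    (hz : 20 ≤ ‖z‖) (h : edgePoly a ε z w = 0) : ‖z * w‖ ≠ 2 := by
  intro hu
  have hw : ‖w‖ ≤ 1 / 10 := by
    rw [norm_mul] at hu
    nlinarith [norm_nonneg w]
  have ha' : ‖z * w + a‖ ≤ 3 := (norm_add_le _ _).trans (by rw [hu]; norm_num; linarith)
  have hv : ‖w * (z * w + a)‖ ≤ 3 / 10 := by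
    rw [norm_mul]
    nlinarith [norm_nonneg w, norm_nonneg (z * w + a)]
  have heq : z * w = -(1 + w * (z * w + a) + ε * (w * (z * w + a)) ^ 2) := by
    rw [edgePoly] at h
    linear_combination h
  have h1 : ‖z * w‖ ≤ 1 + 3 / 10 + 1 * (3 / 10) ^ 2 := by
    rw [heq, norm_neg]
    refine (norm_add₃_le).trans ?_
    rw [norm_one, norm_mul (ε : ℂ), norm_pow, norm_real, Real.norm_eq_abs]
    gcongr
  rw [hu] at h1
  norm_num at h1

lemma one_le_norm_mul_of_edgePoly_eq_zero {a ε M : ℝ} {z w : ℂ} (ha : |a| ≤ 1) (hε : |ε| ≤ 1)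
    (hz : ‖z‖ ≤ M) (hw : ‖w‖ ≤ M) (h : edgePoly a ε z w = 0) :
    1 ≤ ‖w‖ * (M + 1 + M * M + M * (M * M + 1) ^ 2) := by
  have hM := (norm_nonneg z).trans hz
  have heq : (-1 : ℂ) = w * (z + a + z * w + ε * (w * (z * w + a) ^ 2)) := by
    rw [edgePoly] at h
    linear_combination -h
  have h1 : (1 : ℝ) = ‖w * (z + a + z * w + ε * (w * (z * w + a) ^ 2))‖ := by rw [← heq]; simp
  refine h1.trans_le ?_
  rw [norm_mul]
  refine mul_le_mul_of_nonneg_left ?_ (norm_nonneg _)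
  have h2 : ‖z * w‖ ≤ M * M := by
    rw [norm_mul]
    exact mul_le_mul hz hw (norm_nonneg _) hM
  have ha' : ‖(a : ℂ)‖ ≤ 1 := by simpa using ha
  have h3 : ‖z * w + a‖ ≤ M * M + 1 := (norm_add_le _ _).trans (add_le_add h2 ha')
  refine (norm_add_le _ _).trans (add_le_add ((norm_add₃_le).trans (by linarith)) ?_)
  rw [norm_mul, norm_mul, norm_pow, norm_real, Real.norm_eq_abs]
  calc |ε| * (‖w‖ * ‖z * w + a‖ ^ 2) ≤ 1 * (M * (M * M + 1) ^ 2) := by gcongr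
    _ = _ := one_mul _

/-- `Im w = O(Im z)` for the solution close to `-1/z`. -/
lemma im_le_im_of_edgePoly_eq_zero_of_large {a ε : ℝ} {z w : ℂ} (ha : |a| ≤ 1) (hε : |ε| ≤ 1)
    (hz : 40 ≤ z.re) (hη : 0 < z.im) (hw0 : 0 ≤ w.im) (hu : ‖z * w‖ ≤ 2)
    (h : edgePoly a ε z w = 0) : w.im ≤ z.im := by
  have hzn : 40 ≤ ‖z‖ := hz.trans (re_le_norm z)
  have hw : ‖w‖ ≤ 1 / 20 := by
    rw [norm_mul] at hu
    nlinarith [norm_nonneg w]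
  have ha' : ‖z * w + a‖ ≤ 3 := (norm_add_le _ _).trans (by simp only [norm_real, Real.norm_eq_abs]; linarith)
  have hv : ‖w * (z * w + a)‖ ≤ 3 / 20 := by
    rw [norm_mul]
    nlinarith [norm_nonneg w, norm_nonneg (z * w + a)]
  set v := w * (z * w + a) with hvdef
  have hvim : |v.im| ≤ w.im * 3 + 1 / 20 * |(z * w).im| := by
    refine (abs_im_mul_le _ _).trans ?_
    rw [abs_of_nonneg hw0, add_im, ofReal_im, add_zero]
    gcongr
  have heq : z * w = -(1 + v + ε * (v * v)) := by
    rw [edgePoly] at h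
    rw [hvdef]
    linear_combination h
  have hvv : |(v * v).im| ≤ 3 / 10 * |v.im| := by
    refine (abs_im_mul_le _ _).trans ?_
    nlinarith [abs_nonneg v.im]
  have huim : |(z * w).im| ≤ |v.im| + 1 * (3 / 10 * |v.im|) := by
    rw [heq]
    simp only [neg_im, add_im, one_im, zero_add, abs_neg, im_ofReal_mul]
    refine (abs_add_le _ _).trans ?_
    rw [abs_mul]
    gcongr
  have h1 : |(z * w).im| ≤ 5 * w.im := by linarith
  have h2 := abs_le.1 h1
  rw [mul_im] at h2
  have h3 := abs_le.1 (abs_re_le_norm w)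
  have h4 : z.im * w.re ≥ -(z.im * (1 / 20)) := by nlinarith
  nlinarith

lemma exists_imBound_remainder (M : ℝ) : ∃ C > 0, ∀ (δ a : ℝ) (z w : ℂ), 0 ≤ δ → |a| ≤ 1 →
    ImBound δ M 1 z → ImBound δ M 1 w → ImBound δ C C (z * (w * (z * w + a) * (w * (z * w + a)))) := by
  obtain ⟨A, B, h⟩ : ∃ A B : ℝ, ∀ (δ a : ℝ) (z w : ℂ), 0 ≤ δ → |a| ≤ 1 →
      ImBound δ M 1 z → ImBound δ M 1 w →
      ImBound δ A B (z * (w * (z * w + a) * (w * (z * w + a)))) :=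
    ⟨_, _, fun δ a z w _ ha hz hw =>
      hz.mul ((hw.mul ((hz.mul hw).add (.ofReal ha))).mul
        (hw.mul ((hz.mul hw).add (.ofReal ha))))⟩
  refine ⟨|A| + |B| + 1, by positivity, fun δ a z w hδ ha hz hw => (h δ a z w hδ ha hz hw).mono hδ ?_ ?_⟩
  · linarith [le_abs_self A, abs_nonneg B]
  · linarith [le_abs_self B, abs_nonneg A]

lemma sq_eq_of_edgePoly_eq_zero {a ε : ℝ} {z w : ℂ} (h : edgePoly a ε z w = 0) :
    (2 * z * w + z + a) * (2 * z * w + z + a) = (z + a) * (z + a) - 4 * z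
      - ((4 * ε : ℝ) : ℂ) * (z * (w * (z * w + a) * (w * (z * w + a)))) := by
  rw [edgePoly] at h
  push_cast
  linear_combination 4 * z * h

/-- `Im w` is bounded below where the discriminant `(E + a)² - 4E` is negative. -/
lemma le_im_of_edgePoly_eq_zero_of_bulk {a ε M C σ : ℝ} {z w : ℂ} (hM : 1 ≤ M) (hη : 0 < z.im)
    (hzM : ‖z‖ ≤ M) (hwM : ‖w‖ ≤ M) (hw0 : 0 ≤ w.im)
    (hD : (z.re + a) ^ 2 - 4 * z.re ≤ -(2 * σ ^ 2))
    (hC : ‖z * (w * (z * w + a) * (w * (z * w + a)))‖ ≤ C)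
    (hε : 4 * |ε| * C ≤ σ ^ 2 / 2) (hησ : (2 * M + 1) * z.im ≤ σ / 2)
    (h : edgePoly a ε z w = 0) : σ / (4 * M) ≤ w.im := by
  have hsq := congrArg re (sq_eq_of_edgePoly_eq_zero h)
  set r := z * (w * (z * w + a) * (w * (z * w + a)))
  have hr : |((4 * ε : ℝ) * r.re)| ≤ σ ^ 2 / 2 := by
    rw [abs_mul, abs_mul, abs_of_nonneg (by norm_num : (0 : ℝ) ≤ 4)]
    refine le_trans ?_ hε
    gcongr
    exact (abs_re_le_norm r).trans hC
  have hr' := abs_le.1 hr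
  have hwr := abs_le.1 ((abs_re_le_norm w).trans hwM)
  have hzr := abs_le.1 ((abs_re_le_norm z).trans hzM)
  set g := 2 * z * w + z + a with hg
  have hgim : g.im = 2 * (z.re * w.im + z.im * w.re) + z.im := by
    simp [hg, mul_im, mul_re]; ring
  have hL : (g * g).re = g.re ^ 2 - g.im ^ 2 := by rw [mul_re]; ring
  have hR : ((z + a) * (z + a) - 4 * z - ((4 * ε : ℝ) : ℂ) * r).re
      = (z.re + a) ^ 2 - 4 * z.re - z.im ^ 2 - 4 * ε * r.re := by
    rw [sub_re, re_ofReal_mul]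
    simp [mul_re]; ring
  rw [hL, hR] at hsq
  have hup : g.im ≤ 2 * M * w.im + (2 * M + 1) * z.im := by
    rw [hgim]
    nlinarith [mul_nonneg hw0 (sub_nonneg.2 hzr.2), mul_nonneg hη.le (sub_nonneg.2 hwr.2)]
  have hlo : -(2 * M * w.im + (2 * M + 1) * z.im) ≤ g.im := by
    rw [hgim]
    nlinarith [mul_nonneg hw0 (neg_le_iff_add_nonneg.1 hzr.1),
      mul_nonneg hη.le (neg_le_iff_add_nonneg.1 hwr.1)]
  have hgsq : g.im ^ 2 ≤ (2 * M * w.im + (2 * M + 1) * z.im) ^ 2 := sq_le_sq' hlo hup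
  have hσ1 : σ ^ 2 ≤ (2 * M * w.im + (2 * M + 1) * z.im) ^ 2 := by
    nlinarith [sq_nonneg g.re]
  have := abs_le_of_sq_le_sq' hσ1 (by positivity)
  rw [div_le_iff₀ (by positivity)]
  linarith [this.2]

/-- `Im w = O(Im z)` where the discriminant `(E + a)² - 4E` is positive. -/
lemma im_le_of_edgePoly_eq_zero_of_outside {a ε M C σ : ℝ} {z w : ℂ} (hM : 1 ≤ M) (ha : |a| ≤ 1)
    (hσ : 0 < σ) (hσ1 : σ ≤ 1)
    (hη : 0 < z.im) (hzM : ‖z‖ ≤ M) (hwM : ‖w‖ ≤ M) (hw0 : 0 ≤ w.im) (hE : 1 ≤ z.re)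
    (hD : 2 * σ ^ 2 ≤ (z.re + a) ^ 2 - 4 * z.re)
    (hC : ImBound (z.im + w.im) C C (z * (w * (z * w + a) * (w * (z * w + a)))))
    (hε : 4 * |ε| * C ≤ σ ^ 2 / 2) (hησ : 2 * z.im ≤ σ)
    (h : edgePoly a ε z w = 0) : w.im ≤ 10 * M / σ * z.im := by
  have hsq := congrArg re (sq_eq_of_edgePoly_eq_zero h)
  have hsqi := congrArg im (sq_eq_of_edgePoly_eq_zero h)
  set r := z * (w * (z * w + a) * (w * (z * w + a)))
  have hr : |((4 * ε : ℝ) * r.re)| ≤ σ ^ 2 / 2 := by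
    rw [abs_mul, abs_mul, abs_of_nonneg (by norm_num : (0 : ℝ) ≤ 4)]
    refine le_trans ?_ hε
    gcongr
    exact (abs_re_le_norm r).trans hC.1
  have hri : |((4 * ε : ℝ) * r.im)| ≤ σ ^ 2 / 2 * (z.im + w.im) := by
    rw [abs_mul, abs_mul, abs_of_nonneg (by norm_num : (0 : ℝ) ≤ 4)]
    calc 4 * |ε| * |r.im| ≤ 4 * |ε| * (C * (z.im + w.im)) := by gcongr; exact hC.2
      _ = 4 * |ε| * C * (z.im + w.im) := by ring
      _ ≤ _ := by gcongr
  have hr' := abs_le.1 hr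
  have hwr := abs_le.1 ((abs_re_le_norm w).trans hwM)
  have hzr := abs_le.1 ((abs_re_le_norm z).trans hzM)
  set g := 2 * z * w + z + a with hg
  have hgim : g.im = 2 * (z.re * w.im + z.im * w.re) + z.im := by
    simp [hg, mul_im, mul_re]; ring
  have hL : (g * g).re = g.re ^ 2 - g.im ^ 2 := by rw [mul_re]; ring
  have hLi : (g * g).im = 2 * (g.re * g.im) := by rw [mul_im]; ring
  have hR : ((z + a) * (z + a) - 4 * z - ((4 * ε : ℝ) : ℂ) * r).re
      = (z.re + a) ^ 2 - 4 * z.re - z.im ^ 2 - 4 * ε * r.re := by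
    rw [sub_re, re_ofReal_mul]
    simp [mul_re]; ring
  have hRi : ((z + a) * (z + a) - 4 * z - ((4 * ε : ℝ) : ℂ) * r).im
      = z.im * (2 * (z.re + a) - 4) - 4 * ε * r.im := by
    rw [sub_im, im_ofReal_mul]
    simp [mul_im]; ring
  rw [hL, hR] at hsq
  rw [hLi, hRi] at hsqi
  have hgre : σ ≤ |g.re| := by
    rw [← abs_of_pos hσ, ← sq_le_sq]
    have : z.im ^ 2 ≤ σ ^ 2 / 4 := by
      linarith [pow_le_pow_left₀ (by positivity) hησ 2]
    linarith [sq_nonneg g.im, hr'.2]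
  have hprod : 2 * (|g.re| * |g.im|) ≤ z.im * (2 * M + 6) + σ ^ 2 / 2 * (z.im + w.im) := by
    have h2 : 2 * (|g.re| * |g.im|) = |2 * (g.re * g.im)| := by rw [abs_mul, abs_mul, abs_two]
    rw [h2, hsqi]
    refine (abs_sub _ _).trans (add_le_add ?_ hri)
    rw [abs_mul, abs_of_pos hη]
    gcongr
    rw [abs_le]
    have := abs_le.1 ha
    constructor <;> linarith
  have hgim_le : 2 * σ * |g.im| ≤ z.im * (2 * M + 6) + σ ^ 2 / 2 * (z.im + w.im) := by
    linarith [mul_le_mul_of_nonneg_right hgre (abs_nonneg g.im)]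
  have hβ : 2 * w.im ≤ |g.im| + (2 * M + 1) * z.im := by
    linarith [le_abs_self g.im, mul_nonneg hη.le (neg_le_iff_add_nonneg.1 hwr.1), mul_nonneg hw0 (sub_nonneg.2 hE)]
  rw [div_mul_eq_mul_div, le_div_iff₀ hσ]
  have h1 : 2 * σ * (2 * w.im) ≤ z.im * (2 * M + 6) + σ ^ 2 / 2 * (z.im + w.im)
      + 2 * σ * ((2 * M + 1) * z.im) := by
    linarith [mul_le_mul_of_nonneg_left hβ (by positivity : 0 ≤ 2 * σ)]
  have h2 : σ ^ 2 ≤ σ := pow_le_of_le_one hσ.le hσ1 two_ne_zero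
  have h3 : σ ^ 2 * (z.im + w.im) ≤ σ * w.im + z.im := by
    linarith [mul_le_mul_of_nonneg_right h2 hw0, mul_le_mul_of_nonneg_right (h2.trans hσ1) hη.le]
  have h4 : 2 * σ * ((2 * M + 1) * z.im) ≤ 2 * ((2 * M + 1) * z.im) := by
    have : 0 ≤ (2 * M + 1) * z.im := by positivity
    linarith [mul_le_mul_of_nonneg_right hσ1 this]
  linarith [mul_le_mul_of_nonneg_right hM hη.le, mul_nonneg hσ.le hw0]

end EdgePolynomial

section SquareRootEdge

set_option maxHeartbeats 1000000 in
/-- Square-root behaviour of a solution `p` of `p²(L + εQ) + ζ(-ν' + pK + εN) = 0` near `ζ = 0`,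
where all the coefficients are almost real. -/
lemma sqrt_edge_bounds {C ν ν' L ε S : ℝ} {p ζ Q N K : ℂ} (hC : 1 ≤ C) (hν : 0 < ν) (hν1 : ν ≤ 1)
    (hνν' : ν ≤ ν') (hν'C : ν' ≤ C) (hL : 1 ≤ L) (hLC : L ≤ C) (hp : 0 ≤ p.im) (hζ : 0 ≤ ζ.im)
    (hQ : ImBound (ζ.im + p.im) C C Q) (hN : ImBound (ζ.im + p.im) C C N)
    (hK : ImBound (ζ.im + p.im) C C K) (hpC : ‖p‖ ≤ C)
    (hS0 : 0 < S) (hS : S ^ 2 = ‖ζ‖) (hSν : 100 * C ^ 3 * S ≤ ν) (hε : 112 * C ^ 3 * |ε| ≤ ν)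
    (h : p ^ 2 * (L + ε * Q) + ζ * (-ν' + p * K + ε * N) = 0) :
    (ζ.re ≤ 0 → 3 / 8 * ν * S ^ 2 ≤ C * p.im ^ 2 ∧ p.im ≤ 3 * C * S) ∧
    (0 ≤ ζ.re → ν / 2 * ζ.im ≤ 23 * C ^ 2 * S * p.im ∧
      ν * S * p.im ≤ 104 * C ^ 3 * ζ.im) := by
  have hC0 : 0 < C := by linarith
  have hC2 : C ≤ C ^ 2 := by nlinarith
  have hC3 : C ^ 2 ≤ C ^ 3 := by nlinarith [sq_nonneg C]
  have hε0 := abs_nonneg ε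
  have hε1 : C ^ 3 * |ε| ≤ 1 / 112 := by linarith
  have hε2 : C ^ 2 * |ε| ≤ 1 / 112 := (mul_le_mul_of_nonneg_right hC3 hε0).trans hε1
  have hε3 : C * |ε| ≤ 1 / 112 := (mul_le_mul_of_nonneg_right hC2 hε0).trans hε2
  have hεν : C * |ε| ≤ ν / 112 := by
    linarith [mul_le_mul_of_nonneg_right (hC2.trans hC3) hε0]
  have hS2 : C ^ 2 * S ≤ ν / 100 := by linarith [mul_le_mul_of_nonneg_right hC3 hS0.le]
  have hS1 : S ≤ 1 / 100 := by
    nlinarith [mul_le_mul_of_nonneg_right (hC.trans (hC2.trans hC3)) hS0.le]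
  have hεQ : ‖(ε : ℂ) * Q‖ ≤ C * |ε| := by
    rw [norm_mul, norm_real, Real.norm_eq_abs, mul_comm]
    exact mul_le_mul_of_nonneg_right hQ.1 hε0
  have hεN : ‖(ε : ℂ) * N‖ ≤ C * |ε| := by
    rw [norm_mul, norm_real, Real.norm_eq_abs, mul_comm]
    exact mul_le_mul_of_nonneg_right hN.1 hε0
  have hpK : ‖p * K‖ ≤ ‖p‖ * C := by
    rw [norm_mul]
    exact mul_le_mul_of_nonneg_left hK.1 (norm_nonneg _)
  -- size of `p`
  have hp2 : ‖p‖ ^ 2 ≤ 6 * C ^ 2 * S ^ 2 := by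
    have h1 : ‖p ^ 2 * (L + ε * Q)‖ = ‖ζ * (-ν' + p * K + ε * N)‖ := by
      rw [eq_neg_of_add_eq_zero_left h, norm_neg]
    rw [norm_mul, norm_mul, norm_pow, ← hS] at h1
    have h2 : 1 / 2 ≤ ‖(L : ℂ) + ε * Q‖ := by
      have := norm_sub_le ((L : ℂ) + ε * Q) (ε * Q)
      rw [add_sub_cancel_right, norm_real, Real.norm_of_nonneg (by linarith)] at this
      linarith
    have h3 : ‖-(ν' : ℂ) + p * K + ε * N‖ ≤ 3 * C ^ 2 := by
      refine norm_add₃_le.trans ?_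
      rw [norm_neg, norm_real, Real.norm_of_nonneg (by linarith)]
      have : ‖p‖ * C ≤ C * C := mul_le_mul_of_nonneg_right hpC hC0.le
      nlinarith
    have h4 := mul_le_mul_of_nonneg_left h2 (sq_nonneg ‖p‖)
    have h5 := mul_le_mul_of_nonneg_left h3 (sq_nonneg S)
    linarith
  have hpS : ‖p‖ ≤ 3 * C * S := by
    refine (sq_le_sq₀ (norm_nonneg _) (by positivity)).1 (hp2.trans ?_)
    nlinarith [sq_nonneg (C * S)]
  have hpK' : ‖p * K‖ ≤ 3 * ν / 100 := by
    have := mul_le_mul_of_nonneg_right hpS hC0.le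
    linarith
  -- the leading order relation
  set e : ℂ := p ^ 2 * L - ζ * ν' with he
  have henorm : ‖e‖ ≤ ν / 8 * S ^ 2 := by
    have : e = -(ζ * (p * K) + (p ^ 2 * (ε * Q) + ζ * (ε * N))) := by
      rw [he]
      linear_combination h
    rw [this, norm_neg]
    refine (norm_add_le _ _).trans ((add_le_add_right (norm_add_le _ _) _).trans ?_)
    rw [norm_mul ζ (p * K), norm_mul (p ^ 2), norm_mul ζ (ε * N), norm_pow, ← hS]
    have h1 := mul_le_mul_of_nonneg_left hpK' (sq_nonneg S)
    have h2 : ‖p‖ ^ 2 * ‖(ε : ℂ) * Q‖ ≤ 6 * C ^ 2 * S ^ 2 * (C * |ε|) :=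
      mul_le_mul hp2 hεQ (norm_nonneg _) (by positivity)
    have h3 := mul_le_mul_of_nonneg_left (hεN.trans hεν) (sq_nonneg S)
    have h4 : 6 * C ^ 2 * S ^ 2 * (C * |ε|) ≤ 6 * S ^ 2 * (ν / 112) := by
      have : C ^ 3 * |ε| ≤ ν / 112 := by linarith
      linarith [mul_le_mul_of_nonneg_left this (by positivity : 0 ≤ 6 * S ^ 2)]
    nlinarith [mul_pos hν (pow_pos hS0 2)]
  have hν'S : ν * S ^ 2 ≤ ν' * S ^ 2 := mul_le_mul_of_nonneg_right hνν' (sq_nonneg S)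
  have hnorm : ν * S ^ 2 - ν / 8 * S ^ 2 ≤ (p.re ^ 2 + p.im ^ 2) * L := by
    have h1 : ζ * ν' = p ^ 2 * L - e := by rw [he]; ring
    have h2 : ‖ζ * ν'‖ ≤ ‖p ^ 2 * L‖ + ‖e‖ := h1 ▸ norm_sub_le _ _
    rw [norm_mul, norm_mul, norm_real, norm_real, norm_pow, ← normSq_eq_norm_sq, normSq_apply,
      Real.norm_of_nonneg (by linarith : (0 : ℝ) ≤ L),
      Real.norm_of_nonneg (by linarith : (0 : ℝ) ≤ ν'), ← hS] at h2
    linarith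
  have hre : (p.re ^ 2 - p.im ^ 2) * L = ν' * ζ.re + e.re := by
    have h1 : (p ^ 2).re = p.re ^ 2 - p.im ^ 2 := by rw [pow_two, mul_re]; ring
    rw [he, sub_re, re_mul_ofReal, re_mul_ofReal, h1]
    ring
  have here := abs_le.1 ((abs_re_le_norm e).trans henorm)
  refine ⟨fun hζre => ⟨?_, ?_⟩, fun hζre => ?_⟩
  · have h1 : ν' * ζ.re ≤ 0 := mul_nonpos_of_nonneg_of_nonpos (by linarith) hζre
    have h2 : p.im ^ 2 * L ≤ p.im ^ 2 * C := mul_le_mul_of_nonneg_left hLC (sq_nonneg _)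
    linarith [here.2]
  · exact (le_abs_self _).trans ((abs_im_le_norm p).trans hpS)
  · have hα : 3 / 8 * ν * S ^ 2 ≤ C * p.re ^ 2 := by
      have h1 : 0 ≤ ν' * ζ.re := mul_nonneg (by linarith) hζre
      have h2 : p.re ^ 2 * L ≤ p.re ^ 2 * C := mul_le_mul_of_nonneg_left hLC (sq_nonneg _)
      linarith [here.1]
    have hα' : ν / (4 * C) * S ≤ |p.re| := by
      refine abs_le_of_sq_le_sq' ?_ (abs_nonneg _) |>.2
      rw [sq_abs]
      have h1 : (ν / (4 * C) * S) ^ 2 * C = ν * ν / (16 * C) * S ^ 2 := by field_simp; ring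
      have h2 : ν * ν / (16 * C) ≤ 3 / 8 * ν := by
        rw [div_le_iff₀ (by positivity)]
        linarith [mul_le_mul_of_nonneg_left (hν1.trans hC) hν.le, mul_pos hν hC0]
      refine le_of_mul_le_mul_right ?_ hC0
      linarith [mul_le_mul_of_nonneg_right h2 (sq_nonneg S)]
    set δ := ζ.im + p.im with hδ
    have hδ0 : 0 ≤ δ := add_nonneg hζ hp
    set N' : ℂ := -(ν' : ℂ) + p * K + ε * N with hN'
    have hN're : |N'.re + ν'| ≤ ν / 8 := by
      have : N'.re + ν' = (p * K).re + (ε * N).re := by simp [hN']; ring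
      rw [this]
      refine (abs_add_le _ _).trans ?_
      linarith [(abs_re_le_norm (p * K)).trans hpK', (abs_re_le_norm ((ε : ℂ) * N)).trans (hεN.trans hεν)]
    have hN'im : |N'.im| ≤ 5 * C ^ 2 * δ := by
      have : N'.im = (p * K).im + ε * N.im := by simp [hN']
      rw [this]
      refine (abs_add_le _ _).trans ?_
      have h1 := abs_im_mul_le p K
      rw [abs_of_nonneg hp] at h1
      have h2 : p.im * ‖K‖ ≤ δ * C := mul_le_mul (by linarith) hK.1 (norm_nonneg _) hδ0
      have h3 : ‖p‖ * |K.im| ≤ (3 * C * S) * (C * δ) := mul_le_mul hpS hK.2 (abs_nonneg _) (by positivity)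
      have h4 : |ε * N.im| ≤ C * |ε| * δ := by
        rw [abs_mul]
        linarith [mul_le_mul_of_nonneg_left hN.2 hε0]
      have h5 := mul_le_mul_of_nonneg_right hε3 hδ0
      have h6 := mul_le_mul_of_nonneg_right hC2 hδ0
      have h7 := mul_le_mul_of_nonneg_right hC hδ0
      have h8 := mul_le_mul_of_nonneg_right hS1 (by positivity : 0 ≤ C ^ 2 * δ)
      linarith
    set Q' : ℂ := L + ε * Q with hQ'
    have hQ're : |Q'.re - L| ≤ 1 / 2 := by
      have : Q'.re - L = (ε * Q).re := by simp [hQ']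
      rw [this]
      linarith [(abs_re_le_norm ((ε : ℂ) * Q)).trans hεQ]
    have hQ'im : |Q'.im| ≤ δ := by
      have : Q'.im = ε * Q.im := by simp [hQ']
      rw [this, abs_mul]
      linarith [mul_le_mul_of_nonneg_left hQ.2 hε0, mul_le_mul_of_nonneg_right hε3 hδ0]
    have him := congrArg im h
    rw [add_im, mul_im, mul_im ζ, zero_im] at him
    have hp2re : |(p ^ 2).re| ≤ 6 * C ^ 2 * S ^ 2 := by
      refine (abs_re_le_norm _).trans ?_
      rwa [norm_pow]
    have hp2im : (p ^ 2).im = 2 * (p.re * p.im) := by rw [pow_two, mul_im]; ring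
    rw [hp2im] at him
    have hr1 : |(p ^ 2).re * Q'.im| ≤ 6 * C ^ 2 * S ^ 2 * δ := by
      rw [abs_mul]
      exact mul_le_mul hp2re hQ'im (abs_nonneg _) (by positivity)
    have hr2 : |ζ.re * N'.im| ≤ S ^ 2 * (5 * C ^ 2 * δ) := by
      rw [abs_mul, hS]
      exact mul_le_mul (abs_re_le_norm ζ) hN'im (abs_nonneg _) (norm_nonneg _)
    have hQpos := abs_le.1 hQ're
    have hNneg := abs_le.1 hN're
    have hmain : |2 * (p.re * p.im) * Q'.re| = 2 * Q'.re * (|p.re| * p.im) := by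
      rw [abs_mul, abs_mul, abs_mul, abs_two, abs_of_nonneg hp,
        abs_of_nonneg (by linarith : 0 ≤ Q'.re)]
      ring
    have hr1' := abs_le.1 hr1
    have hr2' := abs_le.1 hr2
    have hαS : |p.re| ≤ 3 * C * S := (abs_re_le_norm p).trans hpS
    have hαβ : 0 ≤ |p.re| * p.im := mul_nonneg (abs_nonneg _) hp
    have hSS : S ^ 2 ≤ S / 100 := by nlinarith
    have hCSδ : C ^ 2 * S ^ 2 * δ ≤ ν / 100 * S * δ := by
      have := mul_le_mul_of_nonneg_right hS2 (by positivity : 0 ≤ S * δ)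
      linarith
    have hνS : ν * S * ζ.im ≤ ν / 100 * ζ.im := by
      have := mul_le_mul_of_nonneg_right hS1 (mul_nonneg hν.le hζ)
      linarith
    have hηN : ζ.im * (-N'.re) ≤ 2 * C * ζ.im := by
      have : -N'.re ≤ 2 * C := by linarith [hNneg.1]
      linarith [mul_le_mul_of_nonneg_left this hζ]
    have hηN' : 7 / 8 * ν * ζ.im ≤ ζ.im * (-N'.re) := by
      have : 7 / 8 * ν ≤ -N'.re := by linarith [hNneg.2]
      linarith [mul_le_mul_of_nonneg_left this hζ]
    constructor
    · have h1 : ζ.im * (-N'.re) ≤ 2 * Q'.re * (|p.re| * p.im) + 11 * (C ^ 2 * S ^ 2 * δ) := by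
        rw [← hmain]
        linarith [le_abs_self (2 * (p.re * p.im) * Q'.re), hr1'.2, hr2'.2]
      have h2 : 2 * Q'.re * (|p.re| * p.im) ≤ 12 * C ^ 2 * S * p.im := by
        have h3 : |p.re| * p.im ≤ 3 * C * S * p.im := mul_le_mul_of_nonneg_right hαS hp
        have h4 : 2 * Q'.re ≤ 4 * C := by linarith [hQpos.2]
        have := mul_le_mul h4 h3 hαβ (by positivity)
        linarith
      have h5 : ν / 100 * S * δ ≤ ν / 100 * S * ζ.im + C ^ 2 / 100 * S * p.im := by
        have := mul_le_mul_of_nonneg_right (hν1.trans (hC.trans hC2)) (mul_nonneg hS0.le hp)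
        rw [hδ]
        linarith
      have h6 : 0 ≤ C ^ 2 * S * p.im := by positivity
      linarith [mul_nonneg hν.le hζ]
    · have h1 : 2 * Q'.re * (|p.re| * p.im) ≤ ζ.im * (-N'.re) + 11 * (C ^ 2 * S ^ 2 * δ) := by
        rw [← hmain]
        refine abs_le.2 ⟨?_, ?_⟩
        · have : 0 ≤ ζ.im * (-N'.re) := le_trans (by positivity) hηN'
          linarith [hr1'.2, hr2'.2, hr1'.1, hr2'.1]
        · linarith [hr1'.1, hr2'.1]
      have h2 : |p.re| * p.im ≤ 2 * Q'.re * (|p.re| * p.im) := by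
        have : 1 ≤ 2 * Q'.re := by linarith [hQpos.1]
        linarith [mul_le_mul_of_nonneg_right this hαβ]
      have h3 : ν / (4 * C) * S * p.im ≤ |p.re| * p.im := mul_le_mul_of_nonneg_right hα' hp
      have h4 : ν * S * p.im ≤ 4 * C * (|p.re| * p.im) := by
        have : ν * S * p.im = 4 * C * (ν / (4 * C) * S * p.im) := by field_simp
        rw [this]
        gcongr
      have h5 : C * (C ^ 2 * S ^ 2 * δ) ≤ ν / 100 * (S * δ) := by
        have h6 : C ^ 3 * S ≤ ν / 100 := by linarith
        have := mul_le_mul_of_nonneg_right h6 (by positivity : 0 ≤ S * δ)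
        linarith
      have h7 := mul_le_mul_of_nonneg_left (h2.trans h1) (by positivity : 0 ≤ 4 * C)
      have h8 := mul_le_mul_of_nonneg_left hηN (by positivity : 0 ≤ 4 * C)
      have h9 := mul_le_mul_of_nonneg_right hC3 hζ
      have h10 : ν * ζ.im ≤ C ^ 2 * ζ.im :=
        mul_le_mul_of_nonneg_right (hν1.trans (hC.trans hC2)) hζ
      have h11 : 0 ≤ C ^ 3 * ζ.im := by positivity
      have h12 : ν / 100 * (S * δ) = ν * S * ζ.im / 100 + ν * S * p.im / 100 := by rw [hδ]; ring
      linarith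

end SquareRootEdge

section NearEdge

/-- `v` is a double root of `P_L` (for real `L` and `v`). -/
def IsDoubleRoot (a ε L v : ℝ) : Prop :=
  1 + (L + a) * v + L * v ^ 2 + ε * (v * (L * v + a)) ^ 2 = 0 ∧
    L + a + 2 * L * v + 2 * ε * (v * (L * v + a)) * (2 * L * v + a) = 0

lemma IsDoubleRoot.expansion {a ε L v : ℝ} {z w : ℂ} (hr : IsDoubleRoot a ε L v)
    (h : edgePoly a ε z w = 0) :
    (w + (-v : ℝ)) ^ 2 * (L + ε * (((2 * L * v + a : ℝ) + L * (w + (-v : ℝ))) *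
      ((2 * L * v + a : ℝ) + L * (w + (-v : ℝ))) + (2 * (v * (L * v + a)) * L : ℝ))) +
    (z + (-L : ℝ)) * (-((-v * (1 + v) : ℝ) : ℂ) + (w + (-v : ℝ)) *
      ((1 + 2 * v : ℝ) + (w + (-v : ℝ))) +
      ε * (w * w * w * (z * w + L * w + (2 * a : ℝ)))) = 0 := by
  have h1 := congrArg (ofReal : ℝ → ℂ) hr.1
  have h2 := congrArg (ofReal : ℝ → ℂ) hr.2
  rw [edgePoly] at h
  push_cast at h1 h2 ⊢
  linear_combination h - h1 - (w - v) * h2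

lemma exists_imBound_coefficients (M : ℝ) : ∃ C ≥ 1, M ≤ C ∧ ∀ (δ a L v : ℝ) (z w : ℂ), 0 ≤ δ →
    |a| ≤ 1 → |L| ≤ M → |v| ≤ 1 → ImBound δ M 1 z → ImBound δ M 1 w →
    ImBound δ C C (((2 * L * v + a : ℝ) + L * (w + (-v : ℝ))) *
      ((2 * L * v + a : ℝ) + L * (w + (-v : ℝ))) + (2 * (v * (L * v + a)) * L : ℝ)) ∧
    ImBound δ C C (w * w * w * (z * w + L * w + (2 * a : ℝ))) ∧
    ImBound δ C C ((1 + 2 * v : ℝ) + (w + (-v : ℝ))) ∧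
    ImBound δ C C (w + (-v : ℝ)) := by
  have key : ∃ A₁ B₁ A₂ B₂ A₃ B₃ A₄ B₄ : ℝ, ∀ (δ a L v : ℝ) (z w : ℂ), 0 ≤ δ →
      |a| ≤ 1 → |L| ≤ M → |v| ≤ 1 → ImBound δ M 1 z → ImBound δ M 1 w →
      ImBound δ A₁ B₁ (((2 * L * v + a : ℝ) + L * (w + (-v : ℝ))) *
        ((2 * L * v + a : ℝ) + L * (w + (-v : ℝ))) + (2 * (v * (L * v + a)) * L : ℝ)) ∧
      ImBound δ A₂ B₂ (w * w * w * (z * w + L * w + (2 * a : ℝ))) ∧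
      ImBound δ A₃ B₃ ((1 + 2 * v : ℝ) + (w + (-v : ℝ))) ∧
      ImBound δ A₄ B₄ (w + (-v : ℝ)) := by
    iterate 8 apply Exists.intro
    intro δ a L v z w _ ha hL hv hz hw
    have hM : 0 ≤ M := (abs_nonneg _).trans hL
    have hLv : |L * v| ≤ M := by
      rw [abs_mul]
      exact (mul_le_of_le_one_right (abs_nonneg _) hv).trans hL
    have hLva := (abs_add_le (L * v) a).trans (add_le_add hLv ha)
    have h1 : |2 * L * v + a| ≤ 2 * M + 1 := by
      rw [mul_assoc]
      refine (abs_add_le _ _).trans (add_le_add ?_ ha)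
      rw [abs_mul, abs_two]
      linarith
    have h2 : |2 * (v * (L * v + a)) * L| ≤ 2 * (1 * (M + 1)) * M := by
      rw [abs_mul, abs_mul, abs_mul, abs_two]
      gcongr
    have h3 : |2 * a| ≤ 2 := by
      rw [abs_mul, abs_two]
      linarith
    have h4 : |1 + 2 * v| ≤ 3 := by
      have := abs_le.1 hv
      rw [abs_le]
      constructor <;> linarith
    have hp := hw.add (.ofReal (δ := δ) (by rwa [abs_neg] : |-v| ≤ 1))
    have hG := (ImBound.ofReal (δ := δ) h1).add ((ImBound.ofReal (δ := δ) hL).mul hp)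
    exact ⟨(hG.mul hG).add (.ofReal h2),
      ((hw.mul hw).mul hw).mul (((hz.mul hw).add ((ImBound.ofReal hL).mul hw)).add (.ofReal h3)),
      (ImBound.ofReal h4).add hp, hp⟩
  obtain ⟨A₁, B₁, A₂, B₂, A₃, B₃, A₄, B₄, key⟩ := key
  set C := 1 + |M| + |A₁| + |B₁| + |A₂| + |B₂| + |A₃| + |B₃| + |A₄| + |B₄|
  have hC : |M| ≤ C ∧ |A₁| ≤ C ∧ |B₁| ≤ C ∧ |A₂| ≤ C ∧ |B₂| ≤ C ∧ |A₃| ≤ C ∧ |B₃| ≤ C ∧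
      |A₄| ≤ C ∧ |B₄| ≤ C ∧ 1 ≤ C := by
    have := abs_nonneg M
    have := abs_nonneg A₁
    have := abs_nonneg A₂
    have := abs_nonneg A₃
    have := abs_nonneg A₄
    have := abs_nonneg B₁
    have := abs_nonneg B₂
    have := abs_nonneg B₃
    have := abs_nonneg B₄
    refine ⟨?_, ?_, ?_, ?_, ?_, ?_, ?_, ?_, ?_, ?_⟩ <;> simp only [C] <;> linarith
  obtain ⟨h0, h1, h2, h3, h4, h5, h6, h7, h8, h9⟩ := hC
  refine ⟨C, h9, (le_abs_self _).trans h0, fun δ a L v z w hδ ha hL hv hz hw => ?_⟩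
  obtain ⟨k1, k2, k3, k4⟩ := key δ a L v z w hδ ha hL hv hz hw
  exact ⟨k1.mono hδ ((le_abs_self _).trans h1) ((le_abs_self _).trans h2),
    k2.mono hδ ((le_abs_self _).trans h3) ((le_abs_self _).trans h4),
    k3.mono hδ ((le_abs_self _).trans h5) ((le_abs_self _).trans h6),
    k4.mono hδ ((le_abs_self _).trans h7) ((le_abs_self _).trans h8)⟩

/-- Two-sided bounds for `Im w` near a double root. -/
lemma exists_bounds_near_edge (M : ℝ) {ν : ℝ} (hν : 0 < ν) (hν1 : ν ≤ 1) :
    ∃ τ > 0, ∃ ε₀ > 0, ∃ B > 0, ∀ (a ε L v : ℝ) (z w : ℂ), |a| ≤ 1 → |ε| ≤ ε₀ → 1 ≤ L → L ≤ M →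
      |v| ≤ 1 → ν ≤ -v * (1 + v) → IsDoubleRoot a ε L v → ‖z‖ ≤ M → ‖w‖ ≤ M → 0 < z.im →
      0 ≤ w.im → edgePoly a ε z w = 0 → |z.re - L| + z.im ≤ τ →
      (z.re ≤ L → √(|z.re - L| + z.im) ≤ B * w.im ∧ w.im ≤ B * √(|z.re - L| + z.im)) ∧
      (L ≤ z.re → z.im ≤ B * (√(|z.re - L| + z.im) * w.im) ∧
        √(|z.re - L| + z.im) * w.im ≤ B * z.im) := by
  obtain ⟨C, hC, hMC, key⟩ := exists_imBound_coefficients M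
  have hC0 : 0 < C := by linarith
  have hC2 : C ≤ C ^ 2 := by nlinarith
  have hC3 : C ^ 2 ≤ C ^ 3 := by nlinarith [sq_nonneg C]
  refine ⟨(ν / (100 * C ^ 3)) ^ 2, by positivity, ν / (112 * C ^ 3), by positivity,
    208 * C ^ 3 / ν, by positivity, ?_⟩
  intro a ε L v z w ha hε hL hLM hv hνv hr hzM hwM hη hw0 h ht
  have hδ : 0 ≤ z.im + w.im := by linarith
  obtain ⟨k1, k2, k3, k4⟩ := key (z.im + w.im) a L v z w hδ ha
    (by rw [abs_of_nonneg (by linarith)]; exact hLM) hv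
    ⟨hzM, by rw [abs_of_pos hη]; linarith⟩ ⟨hwM, by rw [abs_of_nonneg hw0]; linarith⟩
  set ζ : ℂ := z + (-L : ℝ) with hζ
  have hζim : ζ.im = z.im := by simp [hζ]
  have hζre : ζ.re = z.re - L := by simp [hζ, sub_eq_add_neg]
  have hpim : (w + (-v : ℝ) : ℂ).im = w.im := by simp
  set t := |z.re - L| + z.im with htdef
  have ht0 : 0 < t := by positivity
  set S := √‖ζ‖ with hS
  have hζn : 0 < ‖ζ‖ := by
    refine hη.trans_le ?_
    rw [← hζim]
    exact im_le_norm ζ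
  have hS0 : 0 < S := Real.sqrt_pos.2 hζn
  have hS2 : S ^ 2 = ‖ζ‖ := Real.sq_sqrt hζn.le
  have hζt : ‖ζ‖ ≤ t := by
    refine (norm_le_abs_re_add_abs_im ζ).trans ?_
    rw [hζim, hζre, abs_of_pos hη]
  have htζ : t ≤ 2 * ‖ζ‖ := by
    have h1 := abs_re_le_norm ζ
    have h2 := im_le_norm ζ
    rw [hζre] at h1
    rw [hζim] at h2
    linarith
  have hSt : S ≤ √t := Real.sqrt_le_sqrt hζt
  have htS : √t ≤ 2 * S := by
    rw [Real.sqrt_le_left (by positivity)]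
    nlinarith
  have htτ : √t ≤ ν / (100 * C ^ 3) := by
    rw [Real.sqrt_le_left (by positivity)]
    exact ht
  have main := sqrt_edge_bounds (C := C) (ν := ν) (ν' := -v * (1 + v)) (L := L) (ε := ε) (S := S)
    hC hν hν1 hνv (by nlinarith [abs_le.1 hv]) hL (hLM.trans hMC) (hpim ▸ hw0) (hζim ▸ hη.le)
    (by rw [hpim, hζim]; exact k1) (by rw [hpim, hζim]; exact k2) (by rw [hpim, hζim]; exact k3)
    k4.1 hS0 hS2
    (by
      have := (le_div_iff₀ (by positivity)).1 (hSt.trans htτ)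
      linarith)
    (by
      have := (le_div_iff₀ (by positivity)).1 hε
      linarith)
    (hr.expansion h)
  rw [hpim, hζim, hζre] at main
  have hB : 208 * C ^ 3 ≤ 208 * C ^ 3 / ν := by
    rw [le_div_iff₀ hν]
    exact mul_le_of_le_one_right (by positivity) hν1
  refine ⟨fun hE => ?_, fun hE => ?_⟩
  · obtain ⟨m1, m2⟩ := main.1 (by linarith)
    constructor
    · rw [Real.sqrt_le_left (by positivity), mul_pow]
      have h1 : t * (3 * ν) ≤ 16 * C * w.im ^ 2 := by
        have := mul_le_mul_of_nonneg_left (htζ.trans_eq (by rw [← hS2])) hν.le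
        linarith
      have h2 : 16 * C ≤ 208 * C ^ 3 * (208 * C ^ 3 / ν) * ν := by
        rw [mul_assoc, div_mul_cancel₀ _ hν.ne']
        nlinarith
      have h3 : (208 * C ^ 3 / ν) ^ 2 * ν = 208 * C ^ 3 * (208 * C ^ 3 / ν) := by
        field_simp
      refine le_of_mul_le_mul_right ?_ hν
      have h4 : 208 * C ^ 3 * (208 * C ^ 3 / ν) * ν ≤ 208 * C ^ 3 * (208 * C ^ 3 / ν) :=
        mul_le_of_le_one_right (by positivity) hν1
      have h5 := mul_le_mul_of_nonneg_right (h2.trans h4) (sq_nonneg w.im)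
      rw [mul_right_comm, h3]
      linarith [mul_pos ht0 hν]
    · refine m2.trans (mul_le_mul ?_ hSt hS0.le (by positivity))
      linarith
  · obtain ⟨m1, m2⟩ := main.2 (by linarith)
    constructor
    · refine le_of_mul_le_mul_left ?_ hν
      have h1 : ν * (208 * C ^ 3 / ν * (√t * w.im)) = 208 * C ^ 3 * (√t * w.im) := by
        field_simp
      rw [h1]
      have h2 : S * w.im ≤ √t * w.im := mul_le_mul_of_nonneg_right hSt hw0
      have h3 := mul_le_mul_of_nonneg_left h2 (sq_nonneg C)
      have h4 := mul_le_mul_of_nonneg_right hC3 (by positivity : 0 ≤ √t * w.im)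
      have h5 : 0 ≤ C ^ 3 * (√t * w.im) := by positivity
      linarith
    · refine le_of_mul_le_mul_left ?_ hν
      have h1 : ν * (208 * C ^ 3 / ν * z.im) = 208 * C ^ 3 * z.im := by
        field_simp
      rw [h1]
      have h2 : √t * w.im ≤ 2 * S * w.im := mul_le_mul_of_nonneg_right htS hw0
      have h3 := mul_le_mul_of_nonneg_left h2 hν.le
      linarith

end NearEdge

section EdgeExistence

lemma edge_polynomial_eq {s ε x v : ℝ} (hs : 0 < s) :
    1 + (x + (1 - s ^ 2)) * v + x * v ^ 2 + ε * (v * (x * v + (1 - s ^ 2))) ^ 2 =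
      (1 + s) ^ 2 * (v + 1 / (1 + s)) ^ 2 + (x - (1 + s) ^ 2) * (v * (1 + v)) +
        ε * (v * (x * v + (1 - s ^ 2))) ^ 2 := by
  have : 1 + s ≠ 0 := by positivity
  field_simp
  ring

/-- For small `ε` there is a double root near `((1 + s)², -1/(1 + s))`. -/
lemma exists_isDoubleRoot {s δ : ℝ} (hs : 0 < s) (hs1 : s ≤ 1) (hδ : 0 < δ) :
    ∃ ε₀ > 0, ∀ ε : ℝ, |ε| ≤ ε₀ → ∃ L v : ℝ, |L - (1 + s) ^ 2| ≤ δ ∧ |v + 1 / (1 + s)| ≤ δ ∧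
      IsDoubleRoot (1 - s ^ 2) ε L v := by
  set l : ℝ := (1 + s) ^ 2 with hl
  set w₀ : ℝ := 1 / (1 + s) with hw₀
  set a : ℝ := 1 - s ^ 2 with ha
  have hl1 : 1 ≤ l := by rw [hl]; nlinarith
  have hl4 : l ≤ 4 := by rw [hl]; nlinarith
  have hw1 : w₀ < 1 := by rw [hw₀, div_lt_one (by positivity)]; linarith
  have hw2 : 1 / 2 ≤ w₀ := by rw [hw₀]; gcongr; linarith
  set u₀ : ℝ := w₀ * (1 - w₀) with hu₀
  have hu0 : 0 < u₀ := mul_pos (by linarith) (by linarith)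
  have hu1 : u₀ ≤ 1 / 4 := by rw [hu₀]; nlinarith [sq_nonneg (w₀ - 1 / 2)]
  set r : ℝ := min δ (u₀ / 4) with hr
  have hr0 : 0 < r := by positivity
  have hru : r ≤ u₀ / 4 := min_le_right _ _
  set δ' : ℝ := min δ (r ^ 2) with hδ'
  have hδ0 : 0 < δ' := by positivity
  have hδr : δ' ≤ r ^ 2 := min_le_right _ _
  have hδ1 : δ' ≤ 1 := hδr.trans (by nlinarith)
  set F : ℝ → ℝ → ℝ → ℝ := fun ε x v => 1 + (x + a) * v + x * v ^ 2 + ε * (v * (x * v + a)) ^ 2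
    with hF
  have hFeq : ∀ ε x v, F ε x v = l * (v + w₀) ^ 2 + (x - l) * (v * (1 + v)) +
      ε * (v * (x * v + a)) ^ 2 := fun ε x v => edge_polynomial_eq hs
  set J : Set ℝ := Set.Icc (-w₀ - r) (-w₀ + r) with hJ
  have hJc : IsCompact J := isCompact_Icc
  have hu : ∀ v ∈ J, v * (1 + v) ≤ -(u₀ / 2) ∧ -1 ≤ v * (1 + v) := by
    intro v hv
    constructor
    · have : v * (1 + v) + u₀ = (v + w₀) * (1 + v - w₀) := by rw [hu₀]; ring
      have h1 : (v + w₀) * (1 + v - w₀) ≤ |v + w₀| * |1 + v - w₀| := by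
        rw [← abs_mul]; exact le_abs_self _
      have h2 : |v + w₀| ≤ r := abs_le.2 ⟨by linarith [hv.1], by linarith [hv.2]⟩
      have h3 : |1 + v - w₀| ≤ 2 := abs_le.2 ⟨by linarith [hv.1], by linarith [hv.2]⟩
      have h4 := mul_le_mul h2 h3 (abs_nonneg _) hr0.le
      linarith
    · nlinarith [sq_nonneg (v + 1 / 2)]
  have hpert : ∀ ε x v, v ∈ J → |x - l| ≤ δ' → |ε * (v * (x * v + a)) ^ 2| ≤ |ε| * 484 := by
    intro ε x v hv hx
    have hx' := abs_le.1 hx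
    have hx5 : |x| ≤ 5 := abs_le.2 ⟨by linarith, by linarith⟩
    have hv2 : |v| ≤ 2 := abs_le.2 ⟨by linarith [hv.1], by linarith [hv.2]⟩
    have ha1 : |a| ≤ 1 := abs_le.2 ⟨by rw [ha]; nlinarith, by rw [ha]; nlinarith⟩
    rw [abs_mul, abs_of_nonneg (sq_nonneg (v * (x * v + a)))]
    refine mul_le_mul_of_nonneg_left ?_ (abs_nonneg _)
    rw [← sq_abs, abs_mul]
    have h1 : |x * v + a| ≤ 5 * 2 + 1 := by
      refine (abs_add_le _ _).trans (add_le_add ?_ ha1)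
      rw [abs_mul]
      gcongr
    calc (|v| * |x * v + a|) ^ 2 ≤ (2 * (5 * 2 + 1)) ^ 2 := by gcongr
      _ = 484 := by norm_num
  refine ⟨δ' * u₀ / 2000, by positivity, fun ε hε => ?_⟩
  have hε' : |ε| * 484 ≤ δ' * u₀ / 4 := by linarith [mul_pos hδ0 hu0]
  have hp : ∀ x v, v ∈ J → |x - l| ≤ δ' → |ε * (v * (x * v + a)) ^ 2| ≤ δ' * u₀ / 4 :=
    fun x v hv hx => (hpert ε x v hv hx).trans hε'
  set φ : ℝ → ℝ := fun x => sInf (F ε x '' J) with hφ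
  have hcont : Continuous φ := hJc.continuous_sInf (f := F ε) (by simp only [hF]; fun_prop)
  have hFc : ∀ x, ContinuousOn (F ε x) J := fun x => by
    simp only [hF]
    fun_prop
  have hJne : J.Nonempty := ⟨-w₀, by linarith, by linarith⟩
  have hmin : ∀ x, ∃ v ∈ J, φ x = F ε x v ∧ ∀ y ∈ J, F ε x v ≤ F ε x y :=
    fun x => hJc.exists_sInf_image_eq_and_le hJne (hFc x)
  have hlo : 0 ≤ φ (l - δ') := by
    obtain ⟨v, hv, hφv, -⟩ := hmin (l - δ')
    have hx : |l - δ' - l| ≤ δ' := by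
      rw [sub_sub_cancel_left, abs_neg, abs_of_pos hδ0]
    have h1 := abs_le.1 (hp _ v hv hx)
    have h2 := mul_le_mul_of_nonneg_left (hu v hv).1 hδ0.le
    rw [hφv, hFeq]
    have h3 : 0 ≤ l * (v + w₀) ^ 2 := by positivity
    linarith [mul_pos hδ0 hu0]
  have hhi : φ (l + δ') ≤ 0 := by
    obtain ⟨v, hv, hφv, hle⟩ := hmin (l + δ')
    have hm : -w₀ ∈ J := ⟨by linarith, by linarith⟩
    have hx : |l + δ' - l| ≤ δ' := by
      rw [add_sub_cancel_left, abs_of_pos hδ0]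
    have h1 := abs_le.1 (hp _ _ hm hx)
    have h2 := mul_le_mul_of_nonneg_left (hu _ hm).1 hδ0.le
    rw [hφv]
    refine (hle _ hm).trans ?_
    rw [hFeq]
    have h3 : l * (-w₀ + w₀) ^ 2 = 0 := by ring
    linarith [mul_pos hδ0 hu0]
  obtain ⟨L, hL, hφL⟩ := intermediate_value_Icc' (by linarith : l - δ' ≤ l + δ')
    hcont.continuousOn ⟨hhi, hlo⟩
  obtain ⟨v, hv, hφv, hle⟩ := hmin L
  have hLl : |L - l| ≤ δ' := abs_le.2 ⟨by linarith [hL.1], by linarith [hL.2]⟩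
  have hbd : ∀ y ∈ J, (y + w₀) ^ 2 = r ^ 2 → 0 < F ε L y := by
    intro y hy hyr
    have h1 := abs_le.1 (hp _ y hy hLl)
    rw [hFeq, hyr]
    have h2 : (L - l) * (y * (1 + y)) ≥ -(δ' * (1 / 4)) := by
      have h3 : |y * (1 + y)| ≤ 1 / 4 := by
        rw [abs_le]
        constructor
        · nlinarith [sq_nonneg (y + 1 / 2)]
        · linarith [(hu y hy).1]
      have h4 := mul_le_mul hLl h3 (abs_nonneg _) hδ0.le
      rw [← abs_mul] at h4
      linarith [neg_abs_le ((L - l) * (y * (1 + y)))]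
    have h3 : r ^ 2 ≤ l * r ^ 2 := le_mul_of_one_le_left (sq_nonneg _) hl1
    have h5 : δ' * u₀ ≤ δ' * (1 / 4) := mul_le_mul_of_nonneg_left hu1 hδ0.le
    linarith
  have h0 : F ε L v = 0 := hφv ▸ hφL
  have hv1 : v ≠ -w₀ - r := fun hv' => by
    have := hbd v hv (by rw [hv']; ring)
    linarith
  have hv2 : v ≠ -w₀ + r := fun hv' => by
    have := hbd v hv (by rw [hv']; ring)
    linarith
  have hnhds : J ∈ nhds v := Icc_mem_nhds (lt_of_le_of_ne hv.1 hv1.symm) (lt_of_le_of_ne hv.2 hv2)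
  have hlm : IsLocalMin (F ε L) v := by
    filter_upwards [hnhds] with y hy using hle y hy
  have hd : HasDerivAt (F ε L) (L + a + 2 * L * v + 2 * ε * (v * (L * v + a)) * (2 * L * v + a)) v := by
    have h1 := hasDerivAt_id' v
    have h2 := (((h1.const_mul (L + a)).const_add 1).add ((h1.pow 2).const_mul L)).add
      (((h1.mul ((h1.const_mul L).add_const a)).pow 2).const_mul ε)
    refine HasDerivAt.congr_deriv (f := F ε L) h2 ?_
    simp only [Pi.mul_apply]
    push_cast
    ring
  refine ⟨L, v, hLl.trans (min_le_left _ _), ?_, h0, hlm.hasDerivAt_eq_zero hd⟩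
  exact (abs_le.2 ⟨by linarith [hv.1], by linarith [hv.2]⟩ : |v + w₀| ≤ r).trans (min_le_left _ _)

end EdgeExistence

section APriori

variable {ρ : Measure ℝ}

/-- A continuous function which avoids the value `K` on a vertical segment and is smaller than `K`
at its top is smaller than `K` on the whole segment. -/
lemma lt_of_ne_on_vertical_segment {f : ℂ → ℝ} {z : ℂ} {H K : ℝ} (hH : z.im ≤ H)
    (hf : ContinuousOn f {u : ℂ | z.im ≤ u.im}) (htop : f (z.re + H * I) < K)
    (hne : ∀ t ∈ Set.Icc z.im H, f (z.re + t * I) ≠ K) : f z < K := by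
  by_contra! hK
  have hz : f z = f (z.re + z.im * I) := by rw [re_add_im]
  have hc : ContinuousOn (fun t : ℝ => f (z.re + t * I)) (Set.Icc z.im H) := by
    refine hf.comp (by fun_prop) fun t ht => ?_
    simpa using ht.1
  obtain ⟨t, ht, hft⟩ := intermediate_value_Icc' hH hc ⟨htop.le, hz ▸ hK⟩
  exact hne t ht hft

lemma norm_stTrans_le_of_edgePoly [IsProbabilityMeasure ρ] {a ε c M : ℝ} {z : ℂ} (ha : |a| ≤ 1)
    (hc : 0 < c) (hε : |ε| * ((2 + 3 / c) * (M * (2 + 3 / c) + 1)) ^ 2 ≤ 1)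
    (h : ∀ z : ℂ, 0 < z.im → edgePoly a ε z (stTrans ρ z) = 0) (hcz : c ≤ z.re)
    (hzM : z.re + 3 ≤ M) (hη : 0 < z.im) (hη3 : z.im ≤ 3) : ‖stTrans ρ z‖ ≤ 2 + 3 / c := by
  have hpos : ∀ t ∈ Set.Icc z.im 3, 0 < ((z.re + t * I : ℂ)).im := fun t ht => by
    simpa using hη.trans_le ht.1
  refine (lt_of_ne_on_vertical_segment (f := fun u => ‖stTrans ρ u‖) hη3
    (continuousOn_stTrans hη).norm ?_ fun t ht => ?_).le
  · have h1 := norm_stTrans_le (ρ := ρ) (hpos 3 ⟨hη3, le_rfl⟩)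
    have h2 : ((z.re + (3 : ℝ) * I : ℂ)).im = 3 := by simp
    rw [h2] at h1
    have : 0 < 3 / c := by positivity
    exact h1.trans_lt (by linarith)
  · refine norm_ne_of_edgePoly_eq_zero ha hc ?_ ?_ hε (h _ (hpos t ht))
    · refine hcz.trans ?_
      simpa using re_le_norm (z.re + t * I : ℂ)
    · refine (norm_le_abs_re_add_abs_im _).trans ?_
      have ht0 : 0 < t := hη.trans_le ht.1
      have hre : 0 < z.re := hc.trans_le hcz
      simp only [add_re, ofReal_re, re_ofReal_mul, I_re, mul_zero, add_zero, add_im, ofReal_im,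
        im_ofReal_mul, I_im, mul_one, zero_add, abs_of_pos ht0, abs_of_pos hre]
      linarith [ht.2]

lemma norm_mul_stTrans_le_of_edgePoly [IsProbabilityMeasure ρ] {a ε : ℝ} {z : ℂ} (ha : |a| ≤ 1)
    (hε : |ε| ≤ 1) (h : ∀ z : ℂ, 0 < z.im → edgePoly a ε z (stTrans ρ z) = 0) (hz : 20 ≤ z.re)
    (hη : 0 < z.im) (hηz : z.im ≤ z.re) : ‖z * stTrans ρ z‖ ≤ 2 := by
  have hpos : ∀ t ∈ Set.Icc z.im z.re, 0 < ((z.re + t * I : ℂ)).im := fun t ht => by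
    simpa using hη.trans_le ht.1
  have hre : 0 < z.re := by linarith
  refine (lt_of_ne_on_vertical_segment (f := fun u => ‖u * stTrans ρ u‖) hηz
    (continuousOn_id.mul (continuousOn_stTrans hη)).norm ?_ fun t ht => ?_).le
  · have h1 := norm_stTrans_le (ρ := ρ) (hpos z.re ⟨hηz, le_rfl⟩)
    set u : ℂ := z.re + z.re * I with hu
    have hui : u.im = z.re := by simp [hu]
    have hur : u.re = z.re := by simp [hu]
    have h2 : ‖u‖ < 2 * z.re := by
      refine lt_of_pow_lt_pow_left₀ 2 (by positivity) ?_
      rw [← normSq_eq_norm_sq, normSq_apply, hui, hur]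
      nlinarith
    rw [hui] at h1
    rw [norm_mul]
    calc ‖u‖ * ‖stTrans ρ u‖ ≤ ‖u‖ * (1 / z.re) := by gcongr
      _ < 2 * z.re * (1 / z.re) := by gcongr
      _ = 2 := by field_simp
  · refine norm_mul_ne_two_of_edgePoly_eq_zero ha hε (hz.trans ?_) (h _ (hpos t ht))
    simpa using re_le_norm (z.re + t * I : ℂ)

end APriori

section UniformBounds

/-- Uniform estimates for the Stieltjes transform in terms of an approximate edge `L`. -/
structure EdgeBounds (ρ : Measure ℝ) (s τ η₁ B L : ℝ) : Prop where
  abs_sub_le : |L - (1 + s) ^ 2| ≤ s / 4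
  im_le : ∀ z : ℂ, (1 - s) ^ 2 / 2 ≤ z.re → z.re ≤ 40 → 0 < z.im → z.im ≤ 3 →
    (stTrans ρ z).im ≤ B
  le_im : ∀ z : ℂ, (1 - s) ^ 2 / 2 ≤ z.re → z.re ≤ 40 → 0 < z.im → z.im ≤ 3 →
    z.im ≤ B * (stTrans ρ z).im
  near_left : ∀ z : ℂ, 0 < z.im → |z.re - L| + z.im ≤ τ → z.re ≤ L →
    √(|z.re - L| + z.im) ≤ B * (stTrans ρ z).im ∧ (stTrans ρ z).im ≤ B * √(|z.re - L| + z.im)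
  near_right : ∀ z : ℂ, 0 < z.im → |z.re - L| + z.im ≤ τ → L ≤ z.re →
    z.im ≤ B * (√(|z.re - L| + z.im) * (stTrans ρ z).im) ∧
      √(|z.re - L| + z.im) * (stTrans ρ z).im ≤ B * z.im
  outside : ∀ z : ℂ, 0 < z.im → z.im ≤ η₁ → L + τ / 2 ≤ z.re → (stTrans ρ z).im ≤ B * z.im
  bulk : ∀ z : ℂ, 0 < z.im → z.im ≤ η₁ → (1 - s) ^ 2 + s ≤ z.re → z.re ≤ L - τ / 2 →
    1 ≤ B * (stTrans ρ z).im

set_option maxHeartbeats 1000000 in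
lemma exists_edgeBounds {s : ℝ} (hs : 0 < s) (hs1 : s < 1) :
    ∃ τ > 0, τ ≤ s ∧ ∃ η₁ > 0, η₁ ≤ τ / 2 ∧ ∃ ε₀ > 0, ∃ B ≥ 1, ∀ (ε : ℝ) (ρ : Measure ℝ),
      |ε| ≤ ε₀ → IsProbabilityMeasure ρ →
      (∀ z : ℂ, 0 < z.im → edgePoly (1 - s ^ 2) ε z (stTrans ρ z) = 0) →
      ∃ L, EdgeBounds ρ s τ η₁ B L := by
  have hss : s ^ 2 ≤ s := pow_le_of_le_one hs.le hs1.le two_ne_zero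
  have hs2 : 0 < s ^ 2 := by positivity
  have hl1 : (1 + s) ^ 2 = 1 + 2 * s + s ^ 2 := by ring
  have hl2 : (1 - s) ^ 2 = 1 - 2 * s + s ^ 2 := by ring
  set a : ℝ := 1 - s ^ 2 with ha_def
  have ha : |a| ≤ 1 := abs_le.2 ⟨by linarith, by linarith⟩
  set c : ℝ := (1 - s) ^ 2 / 2 with hc_def
  have hc : 0 < c := by
    have : 0 < 1 - s := by linarith
    positivity
  have hDeq : ∀ E : ℝ, (E + a) ^ 2 - 4 * E = (E - (1 + s) ^ 2) * (E - (1 - s) ^ 2) := fun E => by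
    rw [ha_def]; ring
  set K : ℝ := 2 + 3 / c with hK
  have hK2 : 2 ≤ K := by
    have : 0 < 3 / c := by positivity
    linarith
  set M : ℝ := 43 + K with hM
  have hM1 : 1 ≤ M := by linarith
  set R : ℝ := M + 1 + M * M + M * (M * M + 1) ^ 2 with hR
  have hR0 : 0 < R := by positivity
  have hR2 := sq_nonneg R
  set w₀ : ℝ := 1 / (1 + s) with hw₀
  set u₀ : ℝ := w₀ * (1 - w₀) with hu₀
  have hw1 : w₀ < 1 := by rw [hw₀, div_lt_one (by positivity)]; linarith
  have hw2 : 1 / 2 ≤ w₀ := by rw [hw₀]; gcongr; linarith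
  have hu0 : 0 < u₀ := mul_pos (by linarith) (by linarith)
  have hu1 : u₀ ≤ 1 / 4 := by rw [hu₀]; nlinarith [sq_nonneg (w₀ - 1 / 2)]
  have hu2 : u₀ ≤ 1 - w₀ := by rw [hu₀]; exact mul_le_of_le_one_left (by linarith) hw1.le
  obtain ⟨τ₀, hτ₀, εn, hεn, Bn, hBn, near⟩ :=
    exists_bounds_near_edge M (ν := u₀ / 2) (by linarith) (by linarith)
  obtain ⟨C, hC, rem⟩ := exists_imBound_remainder M
  set τ : ℝ := min τ₀ s with hτ_def
  have hτ : 0 < τ := by positivity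
  have hτs : τ ≤ s := min_le_right _ _
  set δ : ℝ := min (τ / 4) (u₀ / 4) with hδ_def
  have hδ : 0 < δ := by positivity
  have hδτ : δ ≤ τ / 4 := min_le_left _ _
  have hδu : δ ≤ u₀ / 4 := min_le_right _ _
  obtain ⟨εe, hεe, edge⟩ := exists_isDoubleRoot hs hs1.le hδ
  set σ : ℝ := √(τ * s / 8) with hσ_def
  have hσ : 0 < σ := Real.sqrt_pos.2 (by positivity)
  have hσ2 : σ ^ 2 = τ * s / 8 := Real.sq_sqrt (by positivity)
  have hσ1 : σ ≤ 1 := by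
    rw [hσ_def, Real.sqrt_le_one]
    linarith [mul_le_mul hτs hs1.le hs.le hs.le]
  set η₁ : ℝ := min (τ / 2) (σ / (2 * (2 * M + 1))) with hη₁_def
  have hη₁ : 0 < η₁ := by positivity
  set ε₀ : ℝ := min (min εn εe) (min (min 1 (1 / (K * (M * K + 1)) ^ 2)) (σ ^ 2 / (8 * C)))
    with hε₀_def
  have hε₀ : 0 < ε₀ := by positivity
  set B : ℝ := 1 + K + R ^ 2 + Bn + 10 * M / σ + 4 * M / σ with hB_def
  have hB1 : 0 < 10 * M / σ := by positivity
  have hB2 : 0 < 4 * M / σ := by positivity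
  refine ⟨τ, hτ, hτs, η₁, hη₁, min_le_left _ _, ε₀, hε₀, B, by linarith, ?_⟩
  intro ε ρ hε hρ h
  have hεn' : |ε| ≤ εn := hε.trans ((min_le_left _ _).trans (min_le_left _ _))
  have hεe' : |ε| ≤ εe := hε.trans ((min_le_left _ _).trans (min_le_right _ _))
  have hε1 : |ε| ≤ 1 :=
    hε.trans ((min_le_right _ _).trans ((min_le_left _ _).trans (min_le_left _ _)))
  have hεK : |ε| * (K * (M * K + 1)) ^ 2 ≤ 1 := by
    rw [← le_div_iff₀ (by positivity)]
    exact hε.trans ((min_le_right _ _).trans ((min_le_left _ _).trans (min_le_right _ _)))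
  have hεC : 4 * |ε| * C ≤ σ ^ 2 / 2 := by
    have := (le_div_iff₀ (by positivity)).1
      (hε.trans ((min_le_right _ _).trans (min_le_right _ _)))
    linarith
  obtain ⟨L, v, hLl, hvl, hr⟩ := edge ε hεe'
  have hL := abs_le.1 hLl
  have hv := abs_le.1 hvl
  have hm0 : ∀ z : ℂ, 0 < z.im → 0 ≤ (stTrans ρ z).im := fun z hz => stTrans_im_nonneg hz
  have hmK : ∀ z : ℂ, c ≤ z.re → z.re ≤ 40 → 0 < z.im → z.im ≤ 3 → ‖stTrans ρ z‖ ≤ K :=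
    fun z h1 h2 h3 h4 => norm_stTrans_le_of_edgePoly ha hc hεK h h1 (by linarith) h3 h4
  have hzM : ∀ z : ℂ, c ≤ z.re → z.re ≤ 40 → 0 < z.im → z.im ≤ 3 → ‖z‖ ≤ M := by
    intro z h1 h2 h3 h4
    refine (norm_le_abs_re_add_abs_im z).trans ?_
    rw [abs_of_pos h3, abs_of_pos (hc.trans_le h1)]
    linarith
  have hBK : K ≤ B := by linarith
  have hBn' : Bn ≤ B := by linarith
  have hBR : R ^ 2 ≤ B := by linarith
  have hB10 : 10 * M / σ ≤ B := by linarith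
  have hB4 : 4 * M / σ ≤ B := by linarith
  have hnear : ∀ z : ℂ, 0 < z.im → |z.re - L| + z.im ≤ τ → _ := fun z hη ht => by
    have hre := abs_le.1 ((le_add_of_nonneg_right hη.le).trans ht)
    have him : z.im ≤ 3 := by linarith [abs_nonneg (z.re - L)]
    have h1 : c ≤ z.re := by rw [hc_def]; linarith
    have h2 : z.re ≤ 40 := by linarith
    exact near a ε L v z (stTrans ρ z) ha hεn' (by linarith) (by linarith)
      (abs_le.2 ⟨by linarith, by linarith⟩)
      (by
        have h3 : -v * (1 + v) = u₀ - (v + w₀) * (1 + v - w₀) := by rw [hu₀]; ring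
        have h4 : |1 + v - w₀| ≤ 2 := abs_le.2 ⟨by linarith, by linarith⟩
        have h5 := mul_le_mul hvl h4 (abs_nonneg _) hδ.le
        rw [← abs_mul] at h5
        linarith [le_abs_self ((v + w₀) * (1 + v - w₀))])
      hr (hzM z h1 h2 hη him) ((hmK z h1 h2 hη him).trans (by linarith)) hη (hm0 z hη) (h z hη)
      (ht.trans (min_le_left _ _))
  have hησ : ∀ t : ℝ, t ≤ η₁ → (2 * M + 1) * t ≤ σ / 2 := by
    intro t ht
    have := (le_div_iff₀ (by positivity)).1 (ht.trans (min_le_right _ _))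
    linarith
  refine ⟨L, hLl.trans (by linarith), fun z h1 h2 h3 h4 => ?_, fun z h1 h2 h3 h4 => ?_,
    fun z hη ht hE => ?_, fun z hη ht hE => ?_, fun z hη hη1 hE => ?_, fun z hη hη1 hE hE' => ?_⟩
  · exact (im_le_norm _).trans ((hmK z h1 h2 h3 h4).trans hBK)
  · have hm1 := one_le_norm_mul_of_edgePoly_eq_zero ha hε1 (hzM z h1 h2 h3 h4)
      ((hmK z h1 h2 h3 h4).trans (by linarith)) (h z h3)
    calc z.im = z.im * 1 ^ 2 := by ring
      _ ≤ z.im * (‖stTrans ρ z‖ * R) ^ 2 := by gcongr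
      _ = R ^ 2 * (z.im * ‖stTrans ρ z‖ ^ 2) := by ring
      _ ≤ R ^ 2 * (stTrans ρ z).im := by gcongr; exact im_mul_norm_sq_stTrans_le h3
      _ ≤ B * (stTrans ρ z).im := mul_le_mul_of_nonneg_right hBR (hm0 z h3)
  · obtain ⟨m1, m2⟩ := (hnear z hη ht).1 hE
    exact ⟨m1.trans (mul_le_mul_of_nonneg_right hBn' (hm0 z hη)),
      m2.trans (mul_le_mul_of_nonneg_right hBn' (Real.sqrt_nonneg _))⟩
  · obtain ⟨m1, m2⟩ := (hnear z hη ht).2 hE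
    exact ⟨m1.trans (mul_le_mul_of_nonneg_right hBn'
      (mul_nonneg (Real.sqrt_nonneg _) (hm0 z hη))),
      m2.trans (mul_le_mul_of_nonneg_right hBn' hη.le)⟩
  · have hη3 : z.im ≤ 1 := by linarith [hη1.trans (min_le_left _ _)]
    rcases le_total z.re 40 with h40 | h40
    · have h1 : c ≤ z.re := by rw [hc_def]; linarith
      have hzM' := hzM z h1 h40 hη (by linarith)
      have hmM := (hmK z h1 h40 hη (by linarith)).trans (by linarith : K ≤ M)
      have hD : 2 * σ ^ 2 ≤ (z.re + a) ^ 2 - 4 * z.re := by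
        rw [hDeq, hσ2]
        have h5 : τ / 4 ≤ z.re - (1 + s) ^ 2 := by linarith
        have h6 : s ≤ z.re - (1 - s) ^ 2 := by linarith
        have := mul_le_mul h5 h6 hs.le (by linarith)
        linarith
      have := im_le_of_edgePoly_eq_zero_of_outside hM1 ha hσ hσ1 hη hzM' hmM (hm0 z hη)
        (by linarith) hD
        (rem (z.im + (stTrans ρ z).im) a z (stTrans ρ z) (by linarith [hm0 z hη]) ha
          ⟨hzM', by rw [abs_of_pos hη]; linarith [hm0 z hη]⟩
          ⟨hmM, by rw [abs_of_nonneg (hm0 z hη)]; linarith⟩) hεC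
        (by
          have := hησ z.im hη1
          have := mul_le_mul_of_nonneg_right hM1 hη.le
          linarith) (h z hη)
      exact this.trans (mul_le_mul_of_nonneg_right hB10 hη.le)
    · have h2 := norm_mul_stTrans_le_of_edgePoly ha hε1 h (by linarith) hη (by linarith)
      have h3 := im_le_im_of_edgePoly_eq_zero_of_large ha hε1 h40 hη (hm0 z hη) h2 (h z hη)
      exact h3.trans (le_mul_of_one_le_left hη.le (by linarith))
  · have hη3 : z.im ≤ 1 := by linarith [hη1.trans (min_le_left _ _)]
    have h1 : c ≤ z.re := by rw [hc_def]; linarith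
    have h40 : z.re ≤ 40 := by linarith
    have hzM' := hzM z h1 h40 hη (by linarith)
    have hmM := (hmK z h1 h40 hη (by linarith)).trans (by linarith : K ≤ M)
    have hD : (z.re + a) ^ 2 - 4 * z.re ≤ -(2 * σ ^ 2) := by
      rw [hDeq, hσ2]
      have h5 : τ / 4 ≤ (1 + s) ^ 2 - z.re := by linarith
      have h6 : s ≤ z.re - (1 - s) ^ 2 := by linarith
      have := mul_le_mul h5 h6 hs.le (by linarith)
      linarith
    have := le_im_of_edgePoly_eq_zero_of_bulk hM1 hη hzM' hmM (hm0 z hη) hD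
      (rem (z.im + (stTrans ρ z).im) a z (stTrans ρ z) (by linarith [hm0 z hη]) ha
          ⟨hzM', by rw [abs_of_pos hη]; linarith [hm0 z hη]⟩
          ⟨hmM, by rw [abs_of_nonneg (hm0 z hη)]; linarith⟩).1 hεC (hησ z.im hη1) (h z hη)
    rw [div_le_iff₀ (by positivity)] at this
    have h5 : 1 ≤ 4 * M / σ * (stTrans ρ z).im := by
      rw [div_mul_eq_mul_div, le_div_iff₀ hσ]
      linarith
    exact h5.trans (mul_le_mul_of_nonneg_right hB4 (hm0 z hη))

end UniformBounds

section SpectralEdge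

variable {ρ : Measure ℝ} {s τ η₁ B L : ℝ}

lemma EdgeBounds.le_of_mem_measSupport [IsFiniteMeasure ρ] (h : EdgeBounds ρ s τ η₁ B L)
    (hη₁ : 0 < η₁) (hη₁τ : η₁ ≤ τ / 2) (hB : 1 ≤ B) {x : ℝ} (hx : x ∈ measSupport ρ) : x ≤ L := by
  by_contra! hlt
  set b : ℝ := (L + x) / 2 with hb
  have hbL : 0 < √(b - L) := Real.sqrt_pos.2 (by linarith)
  refine hx (Set.Ioc b (x + 1)) (Ioc_mem_nhds (by linarith) (by linarith))
    (measure_Ioc_eq_zero_of_stTrans_im_le (C := B + B / √(b - L)) hη₁ fun E hE η hη hη' => ?_)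
  set z : ℂ := E + η * I with hz
  have hre : z.re = E := by simp [hz]
  have him : z.im = η := by simp [hz]
  have hBb : 0 ≤ B / √(b - L) * η := by positivity
  have hBη : 0 ≤ B * η := by positivity
  rcases le_total (L + τ / 2) E with hE' | hE'
  · have := h.outside z (him ▸ hη) (him ▸ hη'.le) (hre ▸ hE')
    rw [him] at this
    linarith
  · have hEL : L ≤ E := by linarith [hE.1]
    have habs : |E - L| = E - L := abs_of_nonneg (by linarith)
    have h1 := (h.near_right z (him ▸ hη) (by rw [hre, him, habs]; linarith) (hre ▸ hEL)).2
    rw [hre, him, habs] at h1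
    have h2 : √(b - L) ≤ √(E - L + η) := Real.sqrt_le_sqrt (by linarith [hE.1])
    have h3 := mul_le_mul_of_nonneg_right h2 (stTrans_im_nonneg (ρ := ρ) (him ▸ hη : 0 < z.im))
    have h4 : (stTrans ρ z).im ≤ B / √(b - L) * η := by
      rw [div_mul_eq_mul_div, le_div_iff₀ hbL]
      linarith
    linarith

lemma EdgeBounds.mem_measSupport [IsFiniteMeasure ρ] (h : EdgeBounds ρ s τ η₁ B L)
    (hη₁ : 0 < η₁) (hη₁τ : η₁ ≤ τ / 2) (hB : 1 ≤ B) {E : ℝ} (hE : L - τ / 2 ≤ E) (hE' : E < L) :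
    E ∈ measSupport ρ := by
  have hEL : 0 < √(L - E) := Real.sqrt_pos.2 (by linarith)
  refine mem_measSupport_of_le_stTrans_im (c := √(L - E) / B) (by positivity) hη₁ fun η hη hη' => ?_
  set z : ℂ := E + η * I with hz
  have hre : z.re = E := by simp [hz]
  have him : z.im = η := by simp [hz]
  have habs : |E - L| = L - E := by rw [abs_sub_comm, abs_of_pos (by linarith)]
  have h1 := (h.near_left z (him ▸ hη) (by rw [hre, him, habs]; linarith) (hre ▸ hE'.le)).1
  rw [hre, him, habs] at h1
  have h2 : √(L - E) ≤ √(L - E + η) := Real.sqrt_le_sqrt (by linarith)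
  rw [div_le_iff₀ (by positivity)]
  linarith

lemma EdgeBounds.sSup_measSupport [IsFiniteMeasure ρ] (h : EdgeBounds ρ s τ η₁ B L)
    (hη₁ : 0 < η₁) (hη₁τ : η₁ ≤ τ / 2) (hB : 1 ≤ B) : sSup (measSupport ρ) = L := by
  refine IsLUB.csSup_eq ⟨fun x hx => h.le_of_mem_measSupport hη₁ hη₁τ hB hx, fun b hb => ?_⟩
    ⟨L - τ / 2, h.mem_measSupport hη₁ hη₁τ hB le_rfl (by linarith)⟩
  by_contra! hlt
  have h1 : max b (L - τ / 2) < L := max_lt hlt (by linarith)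
  have h2 := hb (h.mem_measSupport (E := (max b (L - τ / 2) + L) / 2) hη₁ hη₁τ hB
    (by linarith [le_max_right b (L - τ / 2)]) (by linarith))
  linarith [le_max_left b (L - τ / 2)]

lemma EdgeBounds.sInf_measSupport_le [IsFiniteMeasure ρ] (h : EdgeBounds ρ s τ η₁ B L) (hs : 0 < s)
    (hτs : τ ≤ s) (hη₁ : 0 < η₁) (hB : 1 ≤ B) : sInf (measSupport ρ) ≤ (1 - s) ^ 2 + s := by
  have hL := abs_le.1 h.abs_sub_le
  have hmem : (1 - s) ^ 2 + s ∈ measSupport ρ := by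
    refine mem_measSupport_of_le_stTrans_im (c := 1 / B) (by positivity) hη₁ fun η hη hη' => ?_
    rw [div_le_iff₀' (by positivity)]
    have him : ((((1 - s) ^ 2 + s : ℝ) : ℂ) + η * I).im = η := by
      simp only [add_im, ofReal_im, im_ofReal_mul, I_im, mul_one, zero_add]
    refine h.bulk _ (hη.trans_eq him.symm) (him.trans_le hη'.le) ?_ ?_ <;>
      simp only [add_re, ofReal_re, re_ofReal_mul, I_re, mul_zero, add_zero]
    · exact le_rfl
    · linarith
  by_cases hbd : BddBelow (measSupport ρ)
  · exact csInf_le hbd hmem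
  · rw [Real.sInf_of_not_bddBelow hbd]
    positivity

lemma EdgeBounds.kappaDist_eq [IsFiniteMeasure ρ] (h : EdgeBounds ρ s τ η₁ B L) (hs : 0 < s)
    (hτs : τ ≤ s) (hη₁ : 0 < η₁) (hη₁τ : η₁ ≤ τ / 2) (hB : 1 ≤ B) {E : ℝ} (hE : L - s ≤ E) :
    kappaDist ρ E = |E - L| := by
  have hL := abs_le.1 h.abs_sub_le
  have hinf := h.sInf_measSupport_le hs hτs hη₁ hB
  rw [kappaDist, h.sSup_measSupport hη₁ hη₁τ hB]
  refine min_eq_right ((abs_le.2 ⟨?_, ?_⟩ : |E - L| ≤ E - sInf (measSupport ρ)).trans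
    (le_abs_self _)) <;> linarith

lemma EdgeBounds.bounds_right [IsFiniteMeasure ρ] (h : EdgeBounds ρ s τ η₁ B L) (hs : 0 < s)
    (hs1 : s < 1) (hτs : τ ≤ s) (hη₁ : 0 < η₁) (hη₁τ : η₁ ≤ τ / 2) (hB : 1 ≤ B) {z : ℂ}
    (hη : 0 < z.im) (hη3 : z.im < 3) (hE : L < z.re) (hE' : z.re ≤ (1 + s) ^ 2 + 1) :
    z.im ≤ 3 * B / (τ * η₁) * (√(|z.re - L| + z.im) * (stTrans ρ z).im) ∧
      √(|z.re - L| + z.im) * (stTrans ρ z).im ≤ 3 * B / (τ * η₁) * z.im := by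
  have hL := abs_le.1 h.abs_sub_le
  have hτ : 0 < τ := by linarith
  have hm := stTrans_im_nonneg (ρ := ρ) hη
  have hlo : (1 - s) ^ 2 / 2 ≤ z.re := by nlinarith
  have h40 : z.re ≤ 40 := by nlinarith
  have h1 := h.im_le z hlo h40 hη hη3.le
  have h2 := h.le_im z hlo h40 hη hη3.le
  have habs : |z.re - L| = z.re - L := abs_of_pos (by linarith)
  set t := |z.re - L| + z.im with ht
  have ht0 : 0 ≤ √t := Real.sqrt_nonneg t
  have ht3 : √t ≤ 3 := by
    rw [Real.sqrt_le_left (by norm_num)]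
    nlinarith
  set D := 3 * B / (τ * η₁) with hD
  have hD0 : 0 < D := by positivity
  have hDτ : 3 * B ≤ D * τ := by
    rw [hD, div_mul_eq_mul_div, le_div_iff₀ (by positivity)]
    have : η₁ ≤ 1 := by linarith
    have := mul_le_mul_of_nonneg_left this (by positivity : 0 ≤ 3 * B * τ)
    linarith
  have hDη : 3 * B ≤ D * η₁ := by
    rw [hD, div_mul_eq_mul_div, le_div_iff₀ (by positivity)]
    have : τ ≤ 1 := by linarith
    have := mul_le_mul_of_nonneg_left this (by positivity : 0 ≤ 3 * B * η₁)
    linarith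
  have hDB : B ≤ D := by
    have := mul_le_mul_of_nonneg_left (by linarith : τ ≤ 1) hD0.le
    linarith
  rcases le_or_gt t τ with htτ | htτ
  · obtain ⟨m1, m2⟩ := h.near_right z hη htτ hE.le
    exact ⟨m1.trans (mul_le_mul_of_nonneg_right hDB (mul_nonneg ht0 hm)),
      m2.trans (mul_le_mul_of_nonneg_right hDB hη.le)⟩
  · have hτt : τ ≤ √t := Real.le_sqrt_of_sq_le (by nlinarith)
    constructor
    · have h3 := mul_le_mul_of_nonneg_left hτt hD0.le
      have h4 := mul_le_mul_of_nonneg_right (hDτ.trans h3) hm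
      have h5 : 0 ≤ B * (stTrans ρ z).im := by positivity
      linarith
    · rcases le_or_gt z.im η₁ with hηη | hηη
      · have h3 := h.outside z hη hηη (by linarith)
        have h4 := mul_le_mul ht3 h3 hm (by norm_num)
        have h5 := mul_le_mul_of_nonneg_right hDη hη.le
        have h6 : D * η₁ * z.im ≤ D * 1 * z.im := by
          gcongr
          linarith
        linarith
      · have h4 := mul_le_mul ht3 h1 hm (by norm_num)
        have h5 := mul_le_mul_of_nonneg_left hηη.le hD0.le
        linarith

lemma EdgeBounds.bounds_left [IsFiniteMeasure ρ] (h : EdgeBounds ρ s τ η₁ B L) (hs : 0 < s)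
    (hs1 : s < 1) (hτs : τ ≤ s) (hη₁ : 0 < η₁) (hη₁τ : η₁ ≤ τ / 2) (hB : 1 ≤ B) {z : ℂ}
    (hη : 0 < z.im) (hη3 : z.im < 3) (hE : L - s ≤ z.re) (hE' : z.re ≤ L) :
    √(|z.re - L| + z.im) ≤ 3 * B / (τ * η₁) * (stTrans ρ z).im ∧
      (stTrans ρ z).im ≤ 3 * B / (τ * η₁) * √(|z.re - L| + z.im) := by
  have hL := abs_le.1 h.abs_sub_le
  have hτ : 0 < τ := by linarith
  have hm := stTrans_im_nonneg (ρ := ρ) hη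
  have hlo : (1 - s) ^ 2 / 2 ≤ z.re := by nlinarith
  have h40 : z.re ≤ 40 := by nlinarith
  have h1 := h.im_le z hlo h40 hη hη3.le
  have h2 := h.le_im z hlo h40 hη hη3.le
  have habs : |z.re - L| = L - z.re := by rw [abs_sub_comm, abs_of_nonneg (by linarith)]
  set t := |z.re - L| + z.im with ht
  have ht0 : 0 ≤ √t := Real.sqrt_nonneg t
  have ht3 : √t ≤ 3 := by
    rw [Real.sqrt_le_left (by norm_num)]
    nlinarith
  set D := 3 * B / (τ * η₁) with hD
  have hD0 : 0 < D := by positivity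
  have hDτ : 3 * B ≤ D * τ := by
    rw [hD, div_mul_eq_mul_div, le_div_iff₀ (by positivity)]
    have : η₁ ≤ 1 := by linarith
    have := mul_le_mul_of_nonneg_left this (by positivity : 0 ≤ 3 * B * τ)
    linarith
  have hDη : 3 * B ≤ D * η₁ := by
    rw [hD, div_mul_eq_mul_div, le_div_iff₀ (by positivity)]
    have : τ ≤ 1 := by linarith
    have := mul_le_mul_of_nonneg_left this (by positivity : 0 ≤ 3 * B * η₁)
    linarith
  have hDB : 3 * B ≤ D := by
    have := mul_le_mul_of_nonneg_left (by linarith : τ ≤ 1) hD0.le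
    linarith
  have hDB' : B ≤ D := by linarith
  rcases le_or_gt t τ with htτ | htτ
  · obtain ⟨m1, m2⟩ := h.near_left z hη htτ hE'
    exact ⟨m1.trans (mul_le_mul_of_nonneg_right hDB' hm),
      m2.trans (mul_le_mul_of_nonneg_right hDB' ht0)⟩
  · have hτt : τ ≤ √t := Real.le_sqrt_of_sq_le (by nlinarith)
    constructor
    · rcases le_or_gt z.im η₁ with hηη | hηη
      · have h3 := h.bulk z hη hηη (by linarith) (by linarith)
        have h4 := mul_le_mul_of_nonneg_right hDB hm
        linarith
      · have h4 := mul_le_mul_of_nonneg_right hDη hm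
        have h5 : η₁ * 3 ≤ η₁ * (D * (stTrans ρ z).im) := by linarith
        exact ht3.trans (le_of_mul_le_mul_left h5 hη₁)
    · have h3 := mul_le_mul_of_nonneg_left hτt hD0.le
      linarith

end SpectralEdge

/-- behaviour of `Im m̃(E + iη)` on `𝓔` for `d > 1`:
`∼ η/√(ϰ+η)` for `E > L₊`, `∼ √(ϰ+η)` for `L₊ - 1/√d ≤ E ≤ L₊`, and `O(1)` for
`E < L₊ - 1/√d`. -/
theorem stmt5 (d : ℝ) (hd : 1 < d) (C₀ : ℝ) (hC₀ : 0 < C₀) :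
    ∃ q₀ > (0:ℝ), ∃ c₁ > (0:ℝ), ∃ C₁ > (0:ℝ), ∀ s4 : ℝ, |s4| ≤ C₀ → ∀ q ≥ q₀,
      ∀ ρ : Measure ℝ, IsProbabilityMeasure ρ →
        (∀ z : ℂ, 0 < z.im → Ppoly d s4 q z (stTrans ρ z) = 0) →
        ∀ z ∈ specDomGT d,
          (sSup (measSupport ρ) < z.re →
            c₁ * (z.im / Real.sqrt (kappaDist ρ z.re + z.im)) ≤ (stTrans ρ z).im ∧
            (stTrans ρ z).im ≤ C₁ * (z.im / Real.sqrt (kappaDist ρ z.re + z.im))) ∧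
          (sSup (measSupport ρ) - 1/Real.sqrt d ≤ z.re ∧ z.re ≤ sSup (measSupport ρ) →
            c₁ * Real.sqrt (kappaDist ρ z.re + z.im) ≤ (stTrans ρ z).im ∧
            (stTrans ρ z).im ≤ C₁ * Real.sqrt (kappaDist ρ z.re + z.im)) ∧
          (z.re < sSup (measSupport ρ) - 1/Real.sqrt d →
            (stTrans ρ z).im ≤ C₁) := by
  set s : ℝ := 1 / √d with hs_def
  have hd0 : 0 < √d := Real.sqrt_pos.2 (by linarith)
  have hs : 0 < s := by positivity
  have hs1 : s < 1 := by
    rw [hs_def, div_lt_one hd0]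
    exact Real.lt_sqrt_of_sq_lt (by linarith)
  have hsd : s ^ 2 = 1 / d := by
    rw [hs_def, div_pow, one_pow, Real.sq_sqrt (by linarith)]
  obtain ⟨τ, hτ, hτs, η₁, hη₁, hη₁τ, ε₀, hε₀, B, hB, key⟩ := exists_edgeBounds hs hs1
  set D := 3 * B / (τ * η₁) with hD
  have hD0 : 0 < D := by positivity
  refine ⟨√(C₀ / ε₀) + 1, by positivity, 1 / D, by positivity, D, hD0, ?_⟩
  intro s4 hs4 q hq ρ hρ hP z ⟨hz1, hz2, hη, hη3⟩
  have hq0 : 0 < q := lt_of_lt_of_le (by positivity) hq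
  have hε : |s4 / q ^ 2| ≤ ε₀ := by
    have h1 : C₀ / ε₀ ≤ q ^ 2 := (Real.sqrt_le_left hq0.le).1 (by linarith)
    rw [abs_div, abs_of_pos (pow_pos hq0 2), div_le_iff₀ (pow_pos hq0 2)]
    rw [div_le_iff₀' hε₀] at h1
    exact hs4.trans h1
  obtain ⟨L, h⟩ := key (s4 / q ^ 2) ρ hε hρ fun z hz => by
    rw [hsd, ← Ppoly_eq_edgePoly]
    exact hP z hz
  rw [lamMinus, ← hs_def] at hz1
  rw [lamPlus, ← hs_def] at hz2
  rw [h.sSup_measSupport hη₁ hη₁τ hB]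
  refine ⟨fun hE => ?_, fun ⟨hE, hE'⟩ => ?_, fun _ => ?_⟩
  · rw [h.kappaDist_eq hs hτs hη₁ hη₁τ hB (by linarith)]
    obtain ⟨m1, m2⟩ := h.bounds_right hs hs1 hτs hη₁ hη₁τ hB hη hη3 hE hz2
    have ht : 0 < √(|z.re - L| + z.im) := Real.sqrt_pos.2 (by positivity)
    constructor
    · rw [one_div, inv_mul_le_iff₀ hD0, div_le_iff₀ ht]
      linarith
    · rw [← mul_div_assoc, le_div_iff₀ ht]
      linarith
  · rw [h.kappaDist_eq hs hτs hη₁ hη₁τ hB hE]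
    obtain ⟨m1, m2⟩ := h.bounds_left hs hs1 hτs hη₁ hη₁τ hB hη hη3 hE hE'
    exact ⟨by rwa [one_div, inv_mul_le_iff₀ hD0], m2⟩
  · refine (h.im_le z hz1 (by nlinarith) hη hη3.le).trans ?_
    rw [hD, le_div_iff₀ (by positivity)]
    have : τ * η₁ ≤ 1 * 1 := by gcongr <;> linarith
    nlinarith
end

section
/- Fix ℓ ∈ ℕ and let F : ℝ → ℂ be (ℓ+1)-times continuously differentiable such that F and all its derivatives up to order ℓ+1 are bounded. There is a numerical constant C > 0 such that for every ℓ there exists C_ℓ ≤ (Cℓ)^ℓ/ℓ! with the following property: for every real random variable Y with 𝔼Y = 0 and finite absolute moments up to order ℓ+2, with cumulants κ^{(1)}, …, κ^{(ℓ+2)}, and every Q > 0, | 𝔼[Y F(Y)] − Σ_{r=1}^{ℓ} (κ^{(r+1)}/r!) 𝔼[F^{(r)}(Y)] | ≤ C_ℓ 𝔼[|Y|^{ℓ+2}] · sup_{|t| ≤ Q} |F^{(ℓ+1)}(t)| + C_ℓ 𝔼[|Y|^{ℓ+2} 𝟙(|Y| > Q)] · sup_{t ∈ ℝ} |F^{(ℓ+1)}(t)|.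 -/
open MeasureTheory ProbabilityTheory

/-- `κ 1, …, κ n` are the cumulants of `Y` (moment–cumulant recursion
`𝔼[Y^m] = Σ_{k=1}^m C(m-1,k-1) κ^{(k)} 𝔼[Y^{m-k}]` for `1 ≤ m ≤ n`). -/
def IsCumulantSeq {Ω : Type*} [MeasurableSpace Ω] (μ : Measure Ω) (Y : Ω → ℝ)
    (n : ℕ) (κ : ℕ → ℝ) : Prop :=
  ∀ m : ℕ, 1 ≤ m → m ≤ n →
    ∫ ω, (Y ω)^m ∂μ
      = ∑ k ∈ Finset.Icc 1 m, ((m-1).choose (k-1) : ℝ) * κ k * ∫ ω, (Y ω)^(m-k) ∂μ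

/-- Taylor's formula at `0`, with a crude constant in the remainder. -/
lemma norm_sub_taylor_le (n : ℕ) : ∀ (G : ℝ → ℂ), ContDiff ℝ n G → ∀ (y B : ℝ),
    (∀ t : ℝ, |t| ≤ |y| → ‖iteratedDeriv n G t‖ ≤ B) →
    ‖G y - ∑ j ∈ Finset.range n, (y ^ j / (j.factorial : ℝ)) • iteratedDeriv j G 0‖
      ≤ |y| ^ n * B := by
  induction n with
  | zero =>
    intro G _ y B h
    simpa using h y le_rfl
  | succ n ih =>
    intro G hG y B h
    have hG' : ContDiff ℝ (n + 1) G := by exact_mod_cast hG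
    have hd : ContDiff ℝ n (deriv G) := (contDiff_succ_iff_deriv.1 hG').2.2
    have hdiff : Differentiable ℝ G := (contDiff_succ_iff_deriv.1 hG').1
    have hB : 0 ≤ B := (norm_nonneg _).trans (h y le_rfl)
    set R : ℝ → ℂ := fun t =>
      G t - ∑ j ∈ Finset.range (n + 1), (t ^ j / (j.factorial : ℝ)) • iteratedDeriv j G 0 with hR
    have hderiv : ∀ t, HasDerivAt R (deriv G t -
        ∑ j ∈ Finset.range n, (t ^ j / (j.factorial : ℝ)) • iteratedDeriv j (deriv G) 0) t := by
      intro t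
      refine (hdiff t).hasDerivAt.sub ?_
      simp only [Finset.sum_range_succ', pow_zero]
      refine HasDerivAt.add_const _ (HasDerivAt.fun_sum fun j _ => ?_)
      have h1 := (((hasDerivAt_pow (j + 1) t).div_const ((j + 1).factorial : ℝ)).smul_const
        (iteratedDeriv (j + 1) G 0))
      rw [iteratedDeriv_succ'] at h1 ⊢
      convert h1 using 2
      rw [Nat.factorial_succ]
      push_cast
      have : (j.factorial : ℝ) ≠ 0 := by positivity
      field_simp
    have hbound : ∀ t ∈ Set.Icc (-|y|) |y|, ‖deriv G t -
        ∑ j ∈ Finset.range n, (t ^ j / (j.factorial : ℝ)) • iteratedDeriv j (deriv G) 0‖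
          ≤ |y| ^ n * B := by
      intro t ht
      have ht' : |t| ≤ |y| := abs_le.2 ht
      refine (ih (deriv G) hd t B fun s hs => ?_).trans (by gcongr)
      rw [← iteratedDeriv_succ']
      exact h s (hs.trans ht')
    have key := (convex_Icc (-|y|) |y|).norm_image_sub_le_of_norm_hasDerivWithin_le
      (fun t _ => (hderiv t).hasDerivWithinAt) hbound
      (x := 0) (y := y) (by simp) (abs_le.1 le_rfl)
    have hR0 : R 0 = 0 := by
      simp [hR, Finset.sum_range_succ']
    rw [hR0, sub_zero, sub_zero, Real.norm_eq_abs] at key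
    calc ‖R y‖ ≤ |y| ^ n * B * |y| := key
      _ = |y| ^ (n + 1) * B := by ring

/-- A power and a truncated power of a nonnegative random variable are positively correlated. -/
lemma integral_pow_mul_setIntegral_pow_le {Ω : Type*} [MeasurableSpace Ω] (μ : Measure Ω)
    [IsProbabilityMeasure μ] {u : Ω → ℝ} (hu : Measurable u) (hu0 : ∀ ω, 0 ≤ u ω) (Q : ℝ)
    {a b : ℕ} (ha : a ≠ 0) (hia : Integrable (fun ω => u ω ^ a) μ)
    (hib : Integrable (fun ω => u ω ^ b) μ) (hiab : Integrable (fun ω => u ω ^ (a + b)) μ) :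
    (∫ ω, u ω ^ a ∂μ) * (∫ ω in {ω | Q < u ω}, u ω ^ b ∂μ)
      ≤ ∫ ω in {ω | Q < u ω}, u ω ^ (a + b) ∂μ := by
  have hs : MeasurableSet {ω | Q < u ω} := measurableSet_lt measurable_const hu
  set m := ∫ ω, u ω ^ a ∂μ with hm
  have hm0 : 0 ≤ m := integral_nonneg fun ω => pow_nonneg (hu0 ω) a
  obtain ⟨t, ht0, ht⟩ : ∃ t : ℝ, 0 ≤ t ∧ t ^ a = m :=
    ⟨m ^ ((a : ℝ)⁻¹), by positivity, Real.rpow_inv_natCast_pow hm0 ha⟩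
  set c : ℝ := if Q < t then t ^ b else 0 with hc
  rw [← integral_indicator hs, ← integral_indicator hs]
  have hib' := hib.indicator hs
  have hiab' := hiab.indicator hs
  set g := Set.indicator {ω | Q < u ω} (fun ω => u ω ^ b) with hg
  set k := Set.indicator {ω | Q < u ω} (fun ω => u ω ^ (a + b)) with hk
  have hpt : ∀ ω, 0 ≤ k ω - m * g ω - c * u ω ^ a + m * c := by
    intro ω
    have hkg : k ω = u ω ^ a * g ω := by
      by_cases h : Q < u ω <;> simp [hk, hg, h, pow_add]
    have hgv : g ω = if Q < u ω then u ω ^ b else 0 := by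
      simp [hg, Set.indicator]
    have : 0 ≤ (u ω ^ a - t ^ a) * (g ω - c) := by
      rcases le_total t (u ω) with h | h
      · refine mul_nonneg (sub_nonneg.2 (pow_le_pow_left₀ ht0 h a)) (sub_nonneg.2 ?_)
        rw [hgv, hc]
        split_ifs with h1 h2
        · exact pow_le_pow_left₀ ht0 h b
        · exact absurd (h1.trans_le h) h2
        · exact pow_nonneg (hu0 ω) b
        · exact le_rfl
      · refine mul_nonneg_of_nonpos_of_nonpos
          (sub_nonpos.2 (pow_le_pow_left₀ (hu0 ω) h a)) (sub_nonpos.2 ?_)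
        rw [hgv, hc]
        split_ifs with h1 h2
        · exact pow_le_pow_left₀ (hu0 ω) h b
        · exact absurd (h1.trans_le h) h2
        · exact pow_nonneg ht0 b
        · exact le_rfl
    rw [hkg, ← ht]
    linarith
  have hmom : 0 ≤ ∫ ω, (k ω - m * g ω - c * u ω ^ a + m * c) ∂μ := integral_nonneg hpt
  have hi1 : Integrable (fun ω => k ω - m * g ω) μ := hiab'.sub (hib'.const_mul m)
  have hi2 : Integrable (fun ω => k ω - m * g ω - c * u ω ^ a) μ := hi1.sub (hia.const_mul c)
  rw [integral_add hi2 (integrable_const _), integral_sub hi1 (hia.const_mul c),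
    integral_sub hiab' (hib'.const_mul m), integral_const_mul, integral_const_mul, ← hm] at hmom
  simp only [integral_const, probReal_univ, one_smul] at hmom
  linarith

lemma integral_pow_mul_integral_pow_le {Ω : Type*} [MeasurableSpace Ω] (μ : Measure Ω)
    [IsProbabilityMeasure μ] {u : Ω → ℝ} (hu : Measurable u) (hu0 : ∀ ω, 0 ≤ u ω)
    {a b : ℕ} (ha : a ≠ 0) (hia : Integrable (fun ω => u ω ^ a) μ)
    (hib : Integrable (fun ω => u ω ^ b) μ) (hiab : Integrable (fun ω => u ω ^ (a + b)) μ) :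
    (∫ ω, u ω ^ a ∂μ) * (∫ ω, u ω ^ b ∂μ) ≤ ∫ ω, u ω ^ (a + b) ∂μ := by
  have h := integral_pow_mul_setIntegral_pow_le μ hu hu0 (-1) ha hia hib hiab
  have hs : {ω | -1 < u ω} = Set.univ := by
    ext ω
    simpa using lt_of_lt_of_le (by norm_num) (hu0 ω)
  simpa [hs] using h

lemma IsCumulantSeq.moment_succ {Ω : Type*} [MeasurableSpace Ω] {μ : Measure Ω} {Y : Ω → ℝ}
    {n : ℕ} {κ : ℕ → ℝ} (h : IsCumulantSeq μ Y n κ) {p : ℕ} (hp : p + 1 ≤ n) :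
    ∫ ω, Y ω ^ (p + 1) ∂μ
      = ∑ i ∈ Finset.range (p + 1), (p.choose i : ℝ) * κ (i + 1) * ∫ ω, Y ω ^ (p - i) ∂μ := by
  rw [h (p + 1) (by omega) hp, ← Finset.Ico_succ_right_eq_Icc, Finset.sum_Ico_eq_sum_range]
  refine Finset.sum_congr (by simp) fun i _ => ?_
  simp only [add_comm 1 i, Nat.add_sub_cancel, Nat.add_sub_add_right]

lemma IsCumulantSeq.abs_le {Ω : Type*} [MeasurableSpace Ω] {μ : Measure Ω}
    [IsProbabilityMeasure μ] {Y : Ω → ℝ} (hY : Measurable Y) {n : ℕ}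
    (hmom : ∀ k : ℕ, k ≤ n → Integrable (fun ω => |Y ω| ^ k) μ)
    {κ : ℕ → ℝ} (h : IsCumulantSeq μ Y n κ) (p : ℕ) (hp : p + 1 ≤ n) :
    |κ (p + 1)| ≤ (p.factorial : ℝ) * 2 ^ p * ∫ ω, |Y ω| ^ (p + 1) ∂μ := by
  induction p using Nat.strong_induction_on with
  | _ p ih =>
  have habs : ∀ k : ℕ, |∫ ω, Y ω ^ k ∂μ| ≤ ∫ ω, |Y ω| ^ k ∂μ := by
    intro k
    simpa only [abs_pow] using abs_integral_le_integral_abs (f := fun ω => Y ω ^ k) (μ := μ)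
  have hrec := h.moment_succ hp
  rw [Finset.sum_range_succ] at hrec
  simp only [Nat.choose_self, Nat.cast_one, one_mul, Nat.sub_self, pow_zero, integral_const,
    probReal_univ, smul_eq_mul, mul_one] at hrec
  set M := ∫ ω, |Y ω| ^ (p + 1) ∂μ with hM
  have hM0 : 0 ≤ M := integral_nonneg fun ω => by positivity
  have hterm : ∀ i ∈ Finset.range p,
      |(p.choose i : ℝ) * κ (i + 1) * ∫ ω, Y ω ^ (p - i) ∂μ| ≤ p.factorial * M * 2 ^ i := by
    intro i hi
    have hi' : i < p := Finset.mem_range.1 hi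
    have hfac : (p.choose i : ℝ) * i.factorial ≤ p.factorial := by
      have := Nat.choose_mul_factorial_mul_factorial hi'.le
      have h2 : p.choose i * i.factorial ≤ p.factorial := by
        rw [← this]
        exact Nat.le_mul_of_pos_right _ (Nat.factorial_pos _)
      exact_mod_cast h2
    have hmm := integral_pow_mul_integral_pow_le μ hY.abs (fun ω => abs_nonneg (Y ω))
      (a := i + 1) (b := p - i) (by omega) (hmom _ (by omega)) (hmom _ (by omega))
      (hmom _ (by omega))
    rw [show i + 1 + (p - i) = p + 1 by omega] at hmm
    have hMi : 0 ≤ ∫ ω, |Y ω| ^ (i + 1) ∂μ := integral_nonneg fun ω => by positivity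
    rw [abs_mul, abs_mul, Nat.abs_cast]
    calc (p.choose i : ℝ) * |κ (i + 1)| * |∫ ω, Y ω ^ (p - i) ∂μ|
        ≤ (p.choose i : ℝ) * ((i.factorial : ℝ) * 2 ^ i * ∫ ω, |Y ω| ^ (i + 1) ∂μ)
            * ∫ ω, |Y ω| ^ (p - i) ∂μ := by
          gcongr
          · exact ih i hi' (by omega)
          · exact habs _
      _ = ((p.choose i : ℝ) * i.factorial) * 2 ^ i
            * ((∫ ω, |Y ω| ^ (i + 1) ∂μ) * ∫ ω, |Y ω| ^ (p - i) ∂μ) := by ring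
      _ ≤ p.factorial * 2 ^ i * M := by gcongr
      _ = p.factorial * M * 2 ^ i := by ring
  have hgeom : ∑ i ∈ Finset.range p, (2 : ℝ) ^ i = 2 ^ p - 1 := by
    rw [geom_sum_eq (by norm_num)]
    norm_num
  have hsum : |∑ i ∈ Finset.range p, (p.choose i : ℝ) * κ (i + 1) * ∫ ω, Y ω ^ (p - i) ∂μ|
      ≤ p.factorial * M * (2 ^ p - 1) := by
    rw [← hgeom, Finset.mul_sum]
    exact (Finset.abs_sum_le_sum_abs _ _).trans (Finset.sum_le_sum hterm)
  have hκ : κ (p + 1) = (∫ ω, Y ω ^ (p + 1) ∂μ)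
      - ∑ i ∈ Finset.range p, (p.choose i : ℝ) * κ (i + 1) * ∫ ω, Y ω ^ (p - i) ∂μ := by
    linarith
  have h1 : (1 : ℝ) ≤ p.factorial := by exact_mod_cast Nat.succ_le_of_lt (Nat.factorial_pos p)
  rw [hκ]
  refine (abs_sub _ _).trans ((add_le_add (habs _) hsum).trans ?_)
  rw [← hM]
  nlinarith [mul_le_mul_of_nonneg_right h1 hM0]

/-- generalized Stein (cumulant expansion) lemma: there is a numerical
constant `C > 0` such that for every `ℓ` there is `C_ℓ ≤ (Cℓ)^ℓ/ℓ!` with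
`|𝔼[YF(Y)] - Σ_{r=1}^ℓ (κ^{(r+1)}/r!) 𝔼[F^{(r)}(Y)]|` bounded by the stated error for
every centered random variable `Y` with finite moments to order `ℓ+2` and every cutoff
`Q > 0`. -/
theorem stmt18 :
    ∃ C > (0:ℝ), ∀ ℓ : ℕ, ∃ Cl : ℝ, Cl ≤ (C * (ℓ:ℝ))^ℓ / (Nat.factorial ℓ : ℝ) ∧
      ∀ (Ω : Type) [MeasurableSpace Ω] (μ : Measure Ω), IsProbabilityMeasure μ →
      ∀ Y : Ω → ℝ, Measurable Y →
        (∀ k : ℕ, k ≤ ℓ + 2 → Integrable (fun ω => |Y ω|^k) μ) →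
        (∫ ω, Y ω ∂μ) = 0 →
        ∀ κ : ℕ → ℝ, IsCumulantSeq μ Y (ℓ + 2) κ →
        ∀ F : ℝ → ℂ, ContDiff ℝ (ℓ + 1 : ℕ) F →
          (∀ r : ℕ, r ≤ ℓ + 1 → ∃ B : ℝ, ∀ x : ℝ, ‖iteratedDeriv r F x‖ ≤ B) →
        ∀ Q : ℝ, 0 < Q →
        ‖(∫ ω, (Y ω : ℂ) * F (Y ω) ∂μ)
            - ∑ r ∈ Finset.Icc 1 ℓ, ((κ (r+1) / (Nat.factorial r : ℝ) : ℝ) : ℂ)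
                * ∫ ω, iteratedDeriv r F (Y ω) ∂μ‖
          ≤ Cl * (∫ ω, |Y ω|^(ℓ+2) ∂μ)
              * (⨆ x ∈ Set.Icc (-Q) Q, ‖iteratedDeriv (ℓ+1) F x‖)
            + Cl * (∫ ω in {ω | Q < |Y ω|}, |Y ω|^(ℓ+2) ∂μ)
              * (⨆ x : ℝ, ‖iteratedDeriv (ℓ+1) F x‖) := by
  refine ⟨4, by norm_num, fun ℓ => ⟨∑ r ∈ Finset.range (ℓ + 1), 2 ^ r, ?_, ?_⟩⟩
  · rcases Nat.eq_zero_or_pos ℓ with rfl | hℓ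
    · simp
    have hfac : (ℓ.factorial : ℝ) ≤ (ℓ : ℝ) ^ ℓ := by exact_mod_cast ℓ.factorial_le_pow
    have hpow : (2 : ℝ) ^ (ℓ + 1) ≤ 4 ^ ℓ := by
      rw [show (4 : ℝ) = 2 ^ 2 by norm_num, ← pow_mul]
      exact pow_le_pow_right₀ (by norm_num) (by omega)
    have hgeom : ∑ r ∈ Finset.range (ℓ + 1), (2 : ℝ) ^ r = 2 ^ (ℓ + 1) - 1 := by
      rw [geom_sum_eq (by norm_num)]
      norm_num
    rw [le_div_iff₀ (by positivity), mul_pow, hgeom]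
    exact mul_le_mul (by linarith) hfac (by positivity) (by positivity)
  intro Ω _ μ hμ Y hY hmom hmean κ hκ F hF hbd Q hQ
  set S := ⨆ x : ℝ, ‖iteratedDeriv (ℓ + 1) F x‖ with hS
  set SQ := ⨆ x ∈ Set.Icc (-Q) Q, ‖iteratedDeriv (ℓ + 1) F x‖ with hSQ
  obtain ⟨B, hB⟩ := hbd (ℓ + 1) le_rfl
  have hS0 : 0 ≤ S := Real.iSup_nonneg fun x => norm_nonneg _
  have hSQ0 : 0 ≤ SQ := Real.iSup_nonneg fun x => Real.iSup_nonneg fun _ => norm_nonneg _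
  have hleS : ∀ t, ‖iteratedDeriv (ℓ + 1) F t‖ ≤ S := fun t =>
    le_ciSup (f := fun x => ‖iteratedDeriv (ℓ + 1) F x‖) ⟨B, by rintro _ ⟨x, rfl⟩; exact hB x⟩ t
  have hB0 : 0 ≤ B := (norm_nonneg _).trans (hB 0)
  have hleSQ : ∀ t, |t| ≤ Q → ‖iteratedDeriv (ℓ + 1) F t‖ ≤ SQ := by
    intro t ht
    have ht' : t ∈ Set.Icc (-Q) Q := abs_le.1 ht
    refine le_trans ?_ (le_ciSup
      (f := fun x => ⨆ (_ : x ∈ Set.Icc (-Q) Q), ‖iteratedDeriv (ℓ + 1) F x‖) ⟨B, ?_⟩ t)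
    · simp only [ht', ciSup_unique, le_refl]
    · rintro _ ⟨x, rfl⟩
      exact Real.iSup_le (fun _ => hB x) hB0
  have hs : MeasurableSet {ω | Q < |Y ω|} := measurableSet_lt measurable_const hY.abs
  set T : ℕ → ℝ → ℂ := fun r y => ∑ j ∈ Finset.range (ℓ + 1 - r),
    (y ^ j / (j.factorial : ℝ)) • iteratedDeriv (r + j) F 0 with hT
  set tail : ℕ → Ω → ℝ := fun k => Set.indicator {ω | Q < |Y ω|} (fun ω => |Y ω| ^ k) with htail
  have htail_int : ∀ k, ∫ ω, tail k ω ∂μ = ∫ ω in {ω | Q < |Y ω|}, |Y ω| ^ k ∂μ :=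
    fun k => integral_indicator hs
  have hrem : ∀ r ≤ ℓ, ∀ ω, ‖iteratedDeriv r F (Y ω) - T r (Y ω)‖
      ≤ SQ * |Y ω| ^ (ℓ + 1 - r) + S * tail (ℓ + 1 - r) ω := by
    intro r hr ω
    have hcd : ContDiff ℝ (ℓ + 1 - r : ℕ) (iteratedDeriv r F) := by
      rw [iteratedDeriv_eq_iterate]
      refine ContDiff.iterate_deriv' (ℓ + 1 - r) r ?_
      rwa [Nat.sub_add_cancel (by omega)]
    have hit : ∀ j, iteratedDeriv j (iteratedDeriv r F) = iteratedDeriv (r + j) F := by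
      intro j
      simp only [iteratedDeriv_eq_iterate, ← Function.iterate_add_apply, add_comm]
    have htay := norm_sub_taylor_le (ℓ + 1 - r) (iteratedDeriv r F) hcd (Y ω)
    simp only [hit, show r + (ℓ + 1 - r) = ℓ + 1 by omega] at htay
    by_cases h : Q < |Y ω|
    · refine (htay S fun t _ => hleS t).trans ?_
      have : tail (ℓ + 1 - r) ω = |Y ω| ^ (ℓ + 1 - r) := by simp [htail, h]
      rw [this, mul_comm]
      exact le_add_of_nonneg_left (by positivity)
    · refine (htay SQ fun t ht => hleSQ t (ht.trans (not_lt.1 h))).trans ?_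
      have : tail (ℓ + 1 - r) ω = 0 := by simp [htail, h]
      rw [this, mul_comm]
      simp
  have hYpow : ∀ k ≤ ℓ + 2, Integrable (fun ω => Y ω ^ k) μ := fun k hk =>
    (integrable_norm_iff (hY.pow_const k).aestronglyMeasurable).1 (by
      simpa only [norm_pow, Real.norm_eq_abs] using hmom k hk)
  have hFint : ∀ r ≤ ℓ, Integrable (fun ω => iteratedDeriv r F (Y ω)) μ := by
    intro r hr
    obtain ⟨b, hb⟩ := hbd r (by omega)
    have hc : Continuous (iteratedDeriv r F) :=
      hF.continuous_iteratedDeriv r (by exact_mod_cast (by omega : r ≤ ℓ + 1))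
    exact Integrable.of_bound (hc.measurable.comp hY).aestronglyMeasurable b
      (Filter.Eventually.of_forall fun ω => hb _)
  have hYF : Integrable (fun ω => (Y ω : ℂ) * F (Y ω)) μ := by
    obtain ⟨b, hb⟩ := hbd 0 (by omega)
    have hY1 : Integrable (fun ω => (Y ω : ℂ)) μ := by
      simpa using (hYpow 1 (by omega)).ofReal (𝕜 := ℂ)
    refine hY1.mul_bdd (c := b) (hF.continuous.measurable.comp hY).aestronglyMeasurable
      (Filter.Eventually.of_forall fun ω => by simpa using hb (Y ω))
  have hTint : ∀ r ≤ ℓ, Integrable (fun ω => T r (Y ω)) μ := fun r hr =>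
    integrable_finsetSum _ fun j hj => ((hYpow j (by
      have := Finset.mem_range.1 hj; omega)).div_const _).smul_const _
  have hYT_eq : ∀ ω, (Y ω : ℂ) * T 0 (Y ω) = ∑ j ∈ Finset.range (ℓ + 1),
      (Y ω ^ (j + 1) / (j.factorial : ℝ)) • iteratedDeriv j F 0 := by
    intro ω
    simp only [hT, Finset.mul_sum, Nat.sub_zero, zero_add, Complex.real_smul]
    refine Finset.sum_congr rfl fun j _ => ?_
    push_cast
    ring
  have hYT_terms : ∀ j ∈ Finset.range (ℓ + 1), Integrable (fun ω =>
      (Y ω ^ (j + 1) / (j.factorial : ℝ)) • iteratedDeriv j F 0) μ := fun j hj =>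
    ((hYpow (j + 1) (by have := Finset.mem_range.1 hj; omega)).div_const _).smul_const _
  have hYT : Integrable (fun ω => (Y ω : ℂ) * T 0 (Y ω)) μ := by
    simp only [hYT_eq]
    exact integrable_finsetSum _ hYT_terms
  have hκ1 : κ 1 = 0 := by
    have := hκ.moment_succ (p := 0) (by omega)
    simpa [hmean] using this.symm
  have hsum : ∀ f : ℕ → ℂ, ∑ r ∈ Finset.Icc 1 ℓ,
      ((κ (r + 1) / (r.factorial : ℝ) : ℝ) : ℂ) * f r
      = ∑ r ∈ Finset.range (ℓ + 1), ((κ (r + 1) / (r.factorial : ℝ) : ℝ) : ℂ) * f r := by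
    intro f
    rw [Finset.range_eq_Ico, Finset.sum_eq_sum_Ico_succ_bot (by omega)]
    simp only [zero_add, hκ1, zero_div, Complex.ofReal_zero, zero_mul]
    rfl
  have hcancel : ∫ ω, (Y ω : ℂ) * T 0 (Y ω) ∂μ
      = ∑ r ∈ Finset.Icc 1 ℓ, ((κ (r + 1) / (r.factorial : ℝ) : ℝ) : ℂ)
          * ∫ ω, T r (Y ω) ∂μ := by
    rw [hsum]
    have hl : ∫ ω, (Y ω : ℂ) * T 0 (Y ω) ∂μ = ∑ j ∈ Finset.range (ℓ + 1),
        ∑ i ∈ Finset.range (j + 1), (κ (i + 1) / (i.factorial : ℝ)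
          * ((∫ ω, Y ω ^ (j - i) ∂μ) / ((j - i).factorial : ℝ)))
            • iteratedDeriv (i + (j - i)) F 0 := by
      simp only [hYT_eq]
      rw [integral_finsetSum _ hYT_terms]
      refine Finset.sum_congr rfl fun j hj => ?_
      have hj' := Finset.mem_range.1 hj
      rw [integral_smul_const, integral_div, hκ.moment_succ (by omega), Finset.sum_div,
        Finset.sum_smul]
      refine Finset.sum_congr rfl fun i hi => ?_
      have hi' : i ≤ j := by have := Finset.mem_range.1 hi; omega
      rw [Nat.add_sub_cancel' hi', Nat.cast_choose ℝ hi']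
      congr 1
      have h1 : (j.factorial : ℝ) ≠ 0 := by positivity
      have h2 : (i.factorial : ℝ) ≠ 0 := by positivity
      have h3 : ((j - i).factorial : ℝ) ≠ 0 := by positivity
      field_simp
    rw [hl, Finset.sum_range_diag_flip (ℓ + 1) (fun i k => (κ (i + 1) / (i.factorial : ℝ)
          * ((∫ ω, Y ω ^ k ∂μ) / (k.factorial : ℝ))) • iteratedDeriv (i + k) F 0)]
    refine Finset.sum_congr rfl fun r hr => ?_
    simp only [hT]
    rw [integral_finsetSum _ fun j hj => ((hYpow j (by
      have := Finset.mem_range.1 hj; omega)).div_const _).smul_const _, Finset.mul_sum]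
    refine Finset.sum_congr rfl fun j _ => ?_
    rw [integral_smul_const, integral_div, mul_smul, Complex.real_smul]
  have hdecomp : (∫ ω, (Y ω : ℂ) * F (Y ω) ∂μ)
      - ∑ r ∈ Finset.Icc 1 ℓ, ((κ (r + 1) / (r.factorial : ℝ) : ℝ) : ℂ)
          * ∫ ω, iteratedDeriv r F (Y ω) ∂μ
      = (∫ ω, (Y ω : ℂ) * (iteratedDeriv 0 F (Y ω) - T 0 (Y ω)) ∂μ)
        - ∑ r ∈ Finset.Icc 1 ℓ, ((κ (r + 1) / (r.factorial : ℝ) : ℝ) : ℂ)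
          * ∫ ω, (iteratedDeriv r F (Y ω) - T r (Y ω)) ∂μ := by
    have h1 : ∑ r ∈ Finset.Icc 1 ℓ, ((κ (r + 1) / (r.factorial : ℝ) : ℝ) : ℂ)
          * ∫ ω, (iteratedDeriv r F (Y ω) - T r (Y ω)) ∂μ
        = ∑ r ∈ Finset.Icc 1 ℓ, ((κ (r + 1) / (r.factorial : ℝ) : ℝ) : ℂ)
          * ∫ ω, iteratedDeriv r F (Y ω) ∂μ
        - ∑ r ∈ Finset.Icc 1 ℓ, ((κ (r + 1) / (r.factorial : ℝ) : ℝ) : ℂ)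
          * ∫ ω, T r (Y ω) ∂μ := by
      rw [← Finset.sum_sub_distrib]
      refine Finset.sum_congr rfl fun r hr => ?_
      have hr' := (Finset.mem_Icc.1 hr).2
      rw [integral_sub (hFint r hr') (hTint r hr'), mul_sub]
    simp only [iteratedDeriv_zero, mul_sub]
    rw [integral_sub hYF hYT, h1, hcancel]
    ring
  set E := SQ * (∫ ω, |Y ω| ^ (ℓ + 2) ∂μ) + S * (∫ ω in {ω | Q < |Y ω|}, |Y ω| ^ (ℓ + 2) ∂μ)
    with hE
  have htailint : ∀ k ≤ ℓ + 2, Integrable (tail k) μ := fun k hk => (hmom k hk).indicator hs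
  have hterm0 : ‖∫ ω, (Y ω : ℂ) * (iteratedDeriv 0 F (Y ω) - T 0 (Y ω)) ∂μ‖ ≤ E := by
    have hle : ∀ ω, ‖(Y ω : ℂ) * (iteratedDeriv 0 F (Y ω) - T 0 (Y ω))‖
        ≤ SQ * |Y ω| ^ (ℓ + 2) + S * tail (ℓ + 2) ω := by
      intro ω
      rw [norm_mul, Complex.norm_real, Real.norm_eq_abs]
      refine (mul_le_mul_of_nonneg_left (hrem 0 (by omega) ω) (abs_nonneg _)).trans_eq ?_
      have : tail (ℓ + 2) ω = |Y ω| * tail (ℓ + 1) ω := by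
        by_cases h : Q < |Y ω| <;> simp [htail, h, pow_succ']
      rw [this, Nat.sub_zero]
      ring
    refine (norm_integral_le_of_norm_le (((hmom _ le_rfl).const_mul SQ).add
      ((htailint _ le_rfl).const_mul S)) (Filter.Eventually.of_forall hle)).trans_eq ?_
    simp only [Pi.add_apply]
    rw [integral_add ((hmom _ le_rfl).const_mul SQ) ((htailint _ le_rfl).const_mul S),
      integral_const_mul, integral_const_mul, htail_int]
  have htermr : ∀ r ∈ Finset.Icc 1 ℓ, ‖((κ (r + 1) / (r.factorial : ℝ) : ℝ) : ℂ)
      * ∫ ω, (iteratedDeriv r F (Y ω) - T r (Y ω)) ∂μ‖ ≤ 2 ^ r * E := by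
    intro r hr
    have hr' := (Finset.mem_Icc.1 hr).2
    have hk : ℓ + 1 - r ≤ ℓ + 2 := by omega
    have hI : ‖∫ ω, (iteratedDeriv r F (Y ω) - T r (Y ω)) ∂μ‖
        ≤ SQ * (∫ ω, |Y ω| ^ (ℓ + 1 - r) ∂μ)
          + S * (∫ ω in {ω | Q < |Y ω|}, |Y ω| ^ (ℓ + 1 - r) ∂μ) := by
      refine (norm_integral_le_of_norm_le (((hmom _ hk).const_mul SQ).add
        ((htailint _ hk).const_mul S)) (Filter.Eventually.of_forall (hrem r hr'))).trans_eq ?_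
      simp only [Pi.add_apply]
      rw [integral_add ((hmom _ hk).const_mul SQ) ((htailint _ hk).const_mul S),
        integral_const_mul, integral_const_mul, htail_int]
    have hM0 : 0 ≤ ∫ ω, |Y ω| ^ (r + 1) ∂μ := integral_nonneg fun ω => by positivity
    have hκr : ‖((κ (r + 1) / (r.factorial : ℝ) : ℝ) : ℂ)‖
        ≤ 2 ^ r * ∫ ω, |Y ω| ^ (r + 1) ∂μ := by
      rw [Complex.norm_real, Real.norm_eq_abs, abs_div, Nat.abs_cast,
        div_le_iff₀ (by positivity)]
      exact (hκ.abs_le hY hmom r (by omega)).trans_eq (by ring)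
    have h1 := integral_pow_mul_integral_pow_le μ hY.abs (fun ω => abs_nonneg (Y ω))
      (a := r + 1) (b := ℓ + 1 - r) (by omega) (hmom _ (by omega)) (hmom _ hk)
      (hmom _ (by omega))
    have h2 := integral_pow_mul_setIntegral_pow_le μ hY.abs (fun ω => abs_nonneg (Y ω)) Q
      (a := r + 1) (b := ℓ + 1 - r) (by omega) (hmom _ (by omega)) (hmom _ hk)
      (hmom _ (by omega))
    rw [show r + 1 + (ℓ + 1 - r) = ℓ + 2 by omega] at h1 h2
    rw [norm_mul]
    refine (mul_le_mul hκr hI (norm_nonneg _) (by positivity)).trans ?_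
    rw [mul_assoc]
    refine mul_le_mul_of_nonneg_left ?_ (by positivity)
    rw [hE]
    nlinarith [mul_le_mul_of_nonneg_left h1 hSQ0, mul_le_mul_of_nonneg_left h2 hS0]
  rw [hdecomp]
  calc _ ≤ E + ∑ r ∈ Finset.Icc 1 ℓ, 2 ^ r * E :=
        (norm_sub_le _ _).trans (add_le_add hterm0 (norm_sum_le_of_le _ htermr))
    _ = (∑ r ∈ Finset.range (ℓ + 1), 2 ^ r) * E := by
        rw [Finset.range_eq_Ico, Finset.sum_eq_sum_Ico_succ_bot (by omega), add_mul,
          Finset.sum_mul]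
        simp only [pow_zero, one_mul]
        rfl
    _ = _ := by rw [hE]; ring
end
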